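/- arXiv:0711.2413 — 3 statements merged into one kernel-verified Lean document; each statement's English description precedes it below -/
import Mathlib

section
/- Let m > n ≥ 2 and let A_1, B_1 ∈ S_n with A_1 ≠ B_1. Let A, B ∈ S_m be the block matrices A = [[A_1,0],[0,0]] and B = [[B_1,0],[0,0]] (with A_1, B_1 in the upper-left n×n corner and zeros elsewhere). If C ∈ S_m is adjacent to both A and B, then there exists C_1 ∈ S_n such that C = [[C_1,0],[0,0]]. -/
open Matrix

/-- The `m × m` block matrix `[[X, 0], [0, 0]]` with `X` in the upper-left
`n × n` corner and zeros elsewhere. -/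
def embedBlock (n m : ℕ) (X : Matrix (Fin n) (Fin n) ℝ) : Matrix (Fin m) (Fin m) ℝ :=
  Matrix.of fun i j =>
    if hi : (i : ℕ) < n then if hj : (j : ℕ) < n then X ⟨i, hi⟩ ⟨j, hj⟩ else 0 else 0

theorem minor_of_rank_one {m : ℕ} (M : Matrix (Fin m) (Fin m) ℝ) (h : M.rank = 1)
    (i j k l : Fin m) : M i j * M k l = M i l * M k j := by
  rw [Matrix.rank_eq_finrank_span_cols] at h
  obtain ⟨v, hv⟩ := finrank_le_one_iff.mp h.le
  have key : ∀ j, ∃ c : ℝ, ∀ i, M i j = c * (v : Fin m → ℝ) i := by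
    intro j
    obtain ⟨c, hc⟩ := hv ⟨M.col j, Submodule.subset_span ⟨j, rfl⟩⟩
    refine ⟨c, fun i => ?_⟩
    have := congrFun (congrArg Subtype.val hc) i
    simpa using this.symm
  obtain ⟨c, hc⟩ := key j
  obtain ⟨d, hd⟩ := key l
  rw [hc, hd, hd, hc]; ring

/-- A matrix adjacent to two distinct block matrices `[[A₁,0],[0,0]]`,
`[[B₁,0],[0,0]]` is itself of this block form. -/
theorem adjacent_to_two_blocks (n m : ℕ) (hn : 2 ≤ n) (hnm : n < m)
    (A₁ B₁ : Matrix (Fin n) (Fin n) ℝ) (hA₁ : A₁.IsSymm) (hB₁ : B₁.IsSymm)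
    (hne : A₁ ≠ B₁)
    (C : Matrix (Fin m) (Fin m) ℝ) (hC : C.IsSymm)
    (h1 : (C - embedBlock n m A₁).rank = 1)
    (h2 : (C - embedBlock n m B₁).rank = 1) :
    ∃ C₁ : Matrix (Fin n) (Fin n) ℝ, C₁.IsSymm ∧ C = embedBlock n m C₁ := by
  have m1 := minor_of_rank_one _ h1
  have m2 := minor_of_rank_one _ h2
  have out : ∀ (X : Matrix (Fin n) (Fin n) ℝ) (i j : Fin m), n ≤ (i : ℕ) ∨ n ≤ (j : ℕ) →
      embedBlock n m X i j = 0 := by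
    intro X i j h
    simp only [embedBlock, Matrix.of_apply]
    split_ifs <;> first | rfl | omega
  have inn : ∀ (X : Matrix (Fin n) (Fin n) ℝ) (i j : Fin n),
      embedBlock n m X ⟨i, by omega⟩ ⟨j, by omega⟩ = X i j := by
    intro X i j
    simp [embedBlock]
  simp only [Matrix.sub_apply] at m1 m2
  have diag : ∀ k : Fin m, n ≤ (k : ℕ) → C k k = 0 := by
    intro k hk
    by_contra hkk
    apply hne
    ext i j
    have a := m1 ⟨i, by omega⟩ ⟨j, by omega⟩ k k
    have b := m2 ⟨i, by omega⟩ ⟨j, by omega⟩ k k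
    rw [inn, out _ k k (.inl hk), out _ _ k (.inr hk), out _ k _ (.inl hk)] at a b
    simp only [sub_zero] at a b
    have := mul_right_cancel₀ hkk (a.trans b.symm)
    linarith
  have row : ∀ k i : Fin m, n ≤ (k : ℕ) → C k i = 0 := by
    intro k i hk
    have a := m1 i i k k
    rw [out _ k k (.inl hk), out _ _ k (.inr hk), out _ k _ (.inl hk), diag k hk,
      ← hC.apply i k] at a
    simp only [sub_zero, mul_zero] at a
    have := mul_self_eq_zero.mp a.symm
    exact this
  refine ⟨Matrix.of fun i j => C ⟨i, by omega⟩ ⟨j, by omega⟩, ?_, ?_⟩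
  · ext i j
    simp [hC.apply]
  · ext i j
    by_cases hi : (i : ℕ) < n
    · by_cases hj : (j : ℕ) < n
      · simp [embedBlock, hi, hj]
      · rw [out _ _ _ (.inr (by omega)), ← hC.apply, row _ _ (by omega)]
    · rw [out _ _ _ (.inl (by omega)), row _ _ (by omega)]
end

section
/- Let m > n ≥ 2 and let Φ : S_n → S_m be an adjacency preserving map with Φ(0) = 0. Suppose Φ(I) = [[K,0],[0,0]] where I is the n×n identity matrix and K ∈ S_n has rank n. Then for every A ∈ S_n there exists A_1 ∈ S_n such that Φ(A) = [[A_1,0],[0,0]]. -/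
open Matrix

lemma rk_one_form {m : ℕ} (X : Matrix (Fin m) (Fin m) ℝ) (hs : X.IsSymm) (hr : X.rank = 1) :
    ∃ (p : ℝ) (u : Fin m → ℝ), p ≠ 0 ∧ u ≠ 0 ∧ ∀ i j, X i j = p * u i * u j := by
  have h1 : Module.finrank ℝ (LinearMap.range X.mulVecLin) = 1 := hr
  obtain ⟨⟨a, ha⟩, hne, hall⟩ := finrank_eq_one_iff'.1 h1
  have hne' : a ≠ 0 := fun h => hne (by ext1; exact h)
  have hcol : ∀ j, ∃ c : ℝ, ∀ i, X i j = c * a i := by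
    intro j
    obtain ⟨c, hc⟩ := hall ⟨X.mulVecLin (Pi.single j 1), LinearMap.mem_range_self _ _⟩
    refine ⟨c, fun i => ?_⟩
    have := congrFun (congrArg Subtype.val hc) i
    simp at this
    exact this.symm
  choose b hb using hcol
  obtain ⟨k, hk⟩ := Function.ne_iff.1 hne'
  simp at hk
  have hsym : ∀ i j, b j * a i = b i * a j := by
    intro i j
    rw [← hb, ← hb]; exact hs.apply j i
  have hbj : ∀ j, b j = b k / a k * a j := by
    intro j
    have := hsym k j
    field_simp
    linarith
  refine ⟨b k / a k, a, ?_, hne', ?_⟩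
  · intro h0
    have : X = 0 := by
      ext i j
      rw [hb, hbj, h0]; simp
    rw [this] at hr
    simp at hr
  · intro i j
    rw [hb, hbj]; ring

lemma rk_one_clique {m : ℕ} (X Y : Matrix (Fin m) (Fin m) ℝ) (hX : X.IsSymm) (hY : Y.IsSymm)
    (rX : X.rank = 1) (rY : Y.rank = 1) (rXY : (X - Y).rank = 1) :
    ∃ c : ℝ, c ≠ 1 ∧ Y = c • X := by
  obtain ⟨p, u, hp, hu, hXe⟩ := rk_one_form X hX rX
  obtain ⟨q, v, hq, hv, hYe⟩ := rk_one_form Y hY rY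
  obtain ⟨r, w, hr, hw, hZe⟩ := rk_one_form (X - Y) (hX.sub hY) rXY
  have hZ : ∀ i j, p * u i * u j - q * v i * v j = r * w i * w j := by
    intro i j
    rw [← hZe, ← hXe, ← hYe]; rfl
  have hpar : ∀ i j, u i * v j = u j * v i := by
    intro i j
    have h : p * q * (u i * v j - u j * v i) ^ 2 = 0 := by
      have e : p * q * (u i * v j - u j * v i) ^ 2 =
        -((p * u i * u i - q * v i * v i) * (p * u j * u j - q * v j * v j) -
          (p * u i * u j - q * v i * v j) * (p * u j * u i - q * v j * v i)) := by ring
      rw [e, hZ, hZ, hZ, hZ]; ring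
    have h2 : u i * v j - u j * v i = 0 := by
      simpa [hp, hq] using h
    linarith
  obtain ⟨k, hk⟩ := Function.ne_iff.1 hu
  simp at hk
  have hYX : Y = (q * (v k / u k) ^ 2 / p) • X := by
    ext i j
    rw [Matrix.smul_apply, hXe, hYe, smul_eq_mul]
    have h1 := hpar k i
    have h2 := hpar k j
    have e1 : v i = v k / u k * u i := by field_simp; linarith
    have e2 : v j = v k / u k * u j := by field_simp; linarith
    rw [e1, e2]
    field_simp
  refine ⟨_, ?_, hYX⟩
  intro h
  rw [h, one_smul] at hYX
  rw [hYX] at rXY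
  simp at rXY

lemma rank_ker {m : ℕ} (X : Matrix (Fin m) (Fin m) ℝ) :
    X.rank + Module.finrank ℝ (LinearMap.ker X.mulVecLin) = m := by
  have := LinearMap.finrank_range_add_finrank_ker X.mulVecLin
  simpa [Matrix.rank] using this

lemma rk_add_le {m : ℕ} (X Y : Matrix (Fin m) (Fin m) ℝ) :
    (X + Y).rank ≤ X.rank + Y.rank := by
  have h : LinearMap.range (X + Y).mulVecLin ≤
      LinearMap.range X.mulVecLin ⊔ LinearMap.range Y.mulVecLin := by
    rintro _ ⟨x, rfl⟩
    rw [Matrix.mulVecLin_add, LinearMap.add_apply]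
    exact Submodule.add_mem_sup (LinearMap.mem_range_self _ _) (LinearMap.mem_range_self _ _)
  exact (Submodule.finrank_mono h).trans (Submodule.finrank_add_le_finrank_add_finrank _ _)

lemma ker_additive {m : ℕ} (X Y : Matrix (Fin m) (Fin m) ℝ)
    (h : X.rank + Y.rank ≤ (X + Y).rank) :
    LinearMap.ker (X + Y).mulVecLin ≤ LinearMap.ker X.mulVecLin := by
  have h1 := rank_ker X
  have h2 := rank_ker Y
  have h3 := rank_ker (X + Y)
  have h4 := Submodule.finrank_sup_add_finrank_inf_eq (LinearMap.ker X.mulVecLin)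
    (LinearMap.ker Y.mulVecLin)
  have h5 := Submodule.finrank_le (LinearMap.ker X.mulVecLin ⊔ LinearMap.ker Y.mulVecLin)
  have h6 : LinearMap.ker X.mulVecLin ⊓ LinearMap.ker Y.mulVecLin ≤
      LinearMap.ker (X + Y).mulVecLin := by
    intro x hx
    simp only [Submodule.mem_inf, LinearMap.mem_ker, Matrix.mulVecLin_apply] at hx ⊢
    rw [Matrix.add_mulVec, hx.1, hx.2, add_zero]
  simp at h5
  have h7 := Submodule.eq_of_le_of_finrank_le h6 (by omega)
  rw [← h7]
  exact inf_le_left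

lemma rank_sub_smul {m : ℕ} (N R : Matrix (Fin m) (Fin m) ℝ) (hR : R.IsSymm) (rR : R.rank = 1)
    (hker : LinearMap.ker N.mulVecLin ≤ LinearMap.ker R.mulVecLin)
    (hlt : (N - R).rank < N.rank) (c : ℝ) (hc : c ≠ 1) :
    LinearMap.ker (N - c • R).mulVecLin = LinearMap.ker N.mulVecLin := by
  have hle : ∀ d : ℝ, LinearMap.ker N.mulVecLin ≤ LinearMap.ker (N - d • R).mulVecLin := by
    intro d x hx
    have h2 := hker hx
    simp only [LinearMap.mem_ker, Matrix.mulVecLin_apply] at hx h2 ⊢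
    rw [Matrix.sub_mulVec, Matrix.smul_mulVec, hx, h2]; simp
  obtain ⟨p, u, hp, hu, hRe⟩ := rk_one_form R hR rR
  have hRv : ∀ x, R *ᵥ x = (p * (u ⬝ᵥ x)) • u := by
    intro x
    ext i
    simp only [Matrix.mulVec, dotProduct, Pi.smul_apply, smul_eq_mul, hRe, Finset.mul_sum,
      Finset.sum_mul]
    refine Finset.sum_congr rfl fun j _ => by ring
  have hx : ∃ x, N *ᵥ x = R *ᵥ x ∧ N *ᵥ x ≠ 0 := by
    by_contra! hcon
    have : LinearMap.ker (N - R).mulVecLin ≤ LinearMap.ker N.mulVecLin := by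
      intro x hx
      simp only [LinearMap.mem_ker, Matrix.mulVecLin_apply] at hx ⊢
      rw [Matrix.sub_mulVec, sub_eq_zero] at hx
      exact hcon x hx
    have := Submodule.finrank_mono this
    have h1 := rank_ker N
    have h2 := rank_ker (N - R)
    omega
  obtain ⟨x, hx, hx0⟩ := hx
  refine le_antisymm ?_ (hle c)
  intro y hy
  by_contra hy0
  simp only [LinearMap.mem_ker, Matrix.mulVecLin_apply] at hy hy0
  rw [Matrix.sub_mulVec, Matrix.smul_mulVec, sub_eq_zero] at hy
  have hax : u ⬝ᵥ x ≠ 0 := by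
    intro h
    apply hx0; rw [hx, hRv, h]; simp
  have hay : u ⬝ᵥ y ≠ 0 := by
    intro h
    apply hy0; rw [hy, hRv, h]; simp
  set s := (u ⬝ᵥ y) / (u ⬝ᵥ x) with hs
  have hs0 : s ≠ 0 := div_ne_zero hay hax
  have hRy : R *ᵥ y = s • R *ᵥ x := by
    rw [hRv, hRv, smul_smul]
    congr 1
    rw [hs]; field_simp
  have hk : y - (c * s) • x ∈ LinearMap.ker N.mulVecLin := by
    simp only [LinearMap.mem_ker, Matrix.mulVecLin_apply]
    rw [Matrix.mulVec_sub, Matrix.mulVec_smul, hy, hRy, hx, smul_smul, sub_self]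
  have hk2 := hker hk
  simp only [LinearMap.mem_ker, Matrix.mulVecLin_apply] at hk2
  rw [Matrix.mulVec_sub, Matrix.mulVec_smul, hRy, ← sub_smul, ← hx] at hk2
  have h3 := (smul_eq_zero.1 hk2).resolve_right hx0
  apply hc
  have : s * (1 - c) = 0 := by linarith
  have := (mul_eq_zero.1 this).resolve_left hs0
  linarith

lemma diag_core {n m : ℕ} (F : (Fin n → ℝ) → Matrix (Fin m) (Fin m) ℝ)
    (hsym : ∀ l, (F l).IsSymm) (h0 : F 0 = 0) (h1 : (F 1).rank = n)
    (hadj : ∀ l i s t, s ≠ t →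
      (F (Function.update l i s) - F (Function.update l i t)).rank = 1) (l : Fin n → ℝ) :
    LinearMap.ker (F 1).mulVecLin ≤ LinearMap.ker (F l).mulVecLin := by
  have path : ∀ (s : Finset (Fin n)) (l k : Fin n → ℝ), (∀ i, i ∉ s → l i = k i) →
      (F l - F k).rank ≤ s.card := by
    intro s
    induction s using Finset.induction_on with
    | empty =>
      intro l k h
      have : l = k := funext fun i => h i (by simp)
      simp [this]
    | insert a s ha ih =>
      intro l k h
      have e : F l - F k = (F l - F (Function.update l a (k a))) +
          (F (Function.update l a (k a)) - F k) := by abel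
      have b1 : (F l - F (Function.update l a (k a))).rank ≤ 1 := by
        by_cases hc : l a = k a
        · rw [← hc]; simp
        · have := hadj l a (l a) (k a) hc
          rw [Function.update_eq_self] at this
          exact this.le
      have b2 := ih (Function.update l a (k a)) k (by
        intro i hi
        by_cases hia : i = a
        · subst hia; simp
        · rw [Function.update_of_ne hia]
          exact h i (by simp [hia, hi]))
      rw [e, Finset.card_insert_of_notMem ha]
      have := rk_add_le (F l - F (Function.update l a (k a)))
        (F (Function.update l a (k a)) - F k)
      omega
  have good : ∀ (s : Finset (Fin n)) (l : Fin n → ℝ), (∀ i, l i ≠ 1) → (∀ i, i ∉ s → l i = 0) →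
      LinearMap.ker (F 1 - F l).mulVecLin = LinearMap.ker (F 1).mulVecLin := by
    intro s
    induction s using Finset.induction_on with
    | empty =>
      intro l _ h
      have : l = 0 := funext fun i => h i (by simp)
      rw [this, h0, sub_zero]
    | insert a s ha ih =>
      intro l hl h
      by_cases hla : l a = 0
      · refine ih l hl fun i hi => ?_
        by_cases hia : i = a
        · rw [hia, hla]
        · exact h i (by simp [hia, hi])
      have hA := ih (Function.update l a 0) (by
          intro i
          by_cases hia : i = a
          · subst hia; simp
          · rw [Function.update_of_ne hia]; exact hl i) (by
          intro i hi
          by_cases hia : i = a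
          · subst hia; simp
          · rw [Function.update_of_ne hia]; exact h i (by simp [hia, hi]))
      have r1 := hadj l a 1 0 one_ne_zero
      have r2 := hadj l a (l a) 0 hla
      have r3 := hadj l a 1 (l a) (hl a).symm
      rw [Function.update_eq_self] at r2 r3
      have r4 := path (Finset.univ.erase a) 1 (Function.update l a 1) (by
        intro i hi
        have : i = a := by simpa using hi
        subst this; simp)
      rw [Finset.card_erase_of_mem (Finset.mem_univ a), Finset.card_univ, Fintype.card_fin] at r4
      set A := F (Function.update l a 0) with hAdef
      set C := F (Function.update l a 1) with hCdef
      have sA : A.IsSymm := hsym _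
      have sC : C.IsSymm := hsym _
      have hn0 : 0 < n := a.pos
      have rN : (F 1 - A).rank = n := by
        have e1 := rank_ker (F 1 - A)
        have e2 := rank_ker (F 1)
        rw [hA] at e1
        omega
      obtain ⟨c, hc, hce⟩ := rk_one_clique (C - A) (F l - A) (sC.sub sA) ((hsym l).sub sA) r1 r2
        (by rw [sub_sub_sub_cancel_right]; exact r3)
      have eN : (C - A) + (F 1 - C) = F 1 - A := by abel
      have hk := ker_additive (C - A) (F 1 - C) (by rw [eN]; omega)
      rw [eN] at hk
      have eC : F 1 - A - (C - A) = F 1 - C := by abel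
      have := rank_sub_smul (F 1 - A) (C - A) (sC.sub sA) r1 hk (by rw [eC]; omega) c hc
      rw [← hce, sub_sub_sub_cancel_right, hA] at this
      exact this
  -- final step
  set s : Finset (Fin n) := Finset.univ.filter fun i => l i = 1 with hs
  set l' : Fin n → ℝ := fun i => if l i = 1 then 0 else l i with hl'
  have g := good Finset.univ l' (by
    intro i
    simp only [hl']
    split_ifs with h
    · exact zero_ne_one
    · exact h) (by simp)
  have b1 := path s l l' (by
    intro i hi
    have : l i ≠ 1 := by simpa [hs] using hi
    simp [hl', this])
  have b2 := path sᶜ 1 l (by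
    intro i hi
    have : l i = 1 := by simpa [hs] using hi
    simp [this])
  have b3 := Finset.card_add_card_compl s
  rw [Fintype.card_fin] at b3
  have rN : (F 1 - F l').rank = n := by
    have e1 := rank_ker (F 1 - F l')
    have e2 := rank_ker (F 1)
    rw [g] at e1
    omega
  have eN : (F l - F l') + (F 1 - F l) = F 1 - F l' := by abel
  have hk := ker_additive (F l - F l') (F 1 - F l) (by rw [eN]; omega)
  rw [eN, g] at hk
  intro x hx
  have k1 := hk hx
  have k2 := hx
  rw [← g] at k2
  simp only [LinearMap.mem_ker, Matrix.mulVecLin_apply, Matrix.sub_mulVec] at hx k1 k2 ⊢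
  rw [hx, zero_sub, neg_eq_zero] at k2
  rw [k2, sub_zero] at k1
  exact k1

lemma rank_embedBlock (n m : ℕ) (hnm : n < m) (K : Matrix (Fin n) (Fin n) ℝ) :
    (embedBlock n m K).rank = K.rank := by
  apply le_antisymm
  · have e : embedBlock n m K =
        (Matrix.of fun (i : Fin m) (j : Fin n) => if (i : ℕ) = j then (1 : ℝ) else 0) * K *
        (Matrix.of fun (i : Fin n) (j : Fin m) => if (i : ℕ) = j then (1 : ℝ) else 0) := by
      ext i j
      simp only [embedBlock, Matrix.mul_apply, Matrix.of_apply]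
      split_ifs with hi hj
      · rw [Finset.sum_eq_single ⟨j, hj⟩, Finset.sum_eq_single ⟨i, hi⟩]
        · simp
        · intro b _ hb
          rw [if_neg, zero_mul]
          intro h; exact hb (Fin.ext h.symm)
        · simp
        · intro b _ hb
          rw [if_neg, mul_zero]
          intro h; exact hb (Fin.ext h)
        · simp
      · symm
        apply Finset.sum_eq_zero
        intro b _
        rw [if_neg, mul_zero]
        intro h; exact hj (h ▸ b.2)
      · symm
        apply Finset.sum_eq_zero
        intro b _
        rw [Finset.sum_eq_zero, zero_mul]
        intro d _
        rw [if_neg, zero_mul]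
        intro h; exact hi (h ▸ d.2)
    rw [e]
    exact (Matrix.rank_mul_le_left _ _).trans (Matrix.rank_mul_le_right _ _)
  · have e : K = (embedBlock n m K).submatrix (Fin.castLE hnm.le) (Fin.castLE hnm.le) := by
      ext i j
      simp [embedBlock]
    conv_lhs => rw [e]
    exact Matrix.rank_submatrix_le _ _ _

lemma rank_conj_diag {n : ℕ} (V W : Matrix (Fin n) (Fin n) ℝ) (hVW : V * W = 1)
    (i : Fin n) (t : ℝ) (ht : t ≠ 0) :
    (V * Matrix.diagonal (Pi.single i t) * W).rank = 1 := by
  have hV : IsUnit V.det := (Matrix.isUnit_det_of_right_inverse hVW)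
  have hW : IsUnit W.det := (Matrix.isUnit_det_of_left_inverse hVW)
  rw [Matrix.rank_mul_eq_left_of_isUnit_det _ _ hW, Matrix.rank_mul_eq_right_of_isUnit_det _ _ hV,
    Matrix.rank_diagonal]
  rw [Fintype.card_eq_one_iff]
  refine ⟨⟨i, by simpa using ht⟩, ?_⟩
  rintro ⟨j, hj⟩
  ext1
  by_contra h
  exact hj (Pi.single_eq_of_ne (M := fun _ => ℝ) (i := i) (i' := j) h t)

/-- If an adjacency preserving map `Φ : S_n → S_m` (`m > n ≥ 2`) with
`Φ(0) = 0` sends the identity to a block matrix `[[K,0],[0,0]]` with `K` of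
full rank `n`, then every value of `Φ` has this block form. -/
theorem block_form (n m : ℕ) (hn : 2 ≤ n) (hnm : n < m)
    (Φ : Matrix (Fin n) (Fin n) ℝ → Matrix (Fin m) (Fin m) ℝ)
    (hΦsym : ∀ A : Matrix (Fin n) (Fin n) ℝ, A.IsSymm → (Φ A).IsSymm)
    (hΦadj : ∀ A B : Matrix (Fin n) (Fin n) ℝ, A.IsSymm → B.IsSymm →
      (A - B).rank = 1 → (Φ A - Φ B).rank = 1)
    (hΦ0 : Φ 0 = 0)
    (K : Matrix (Fin n) (Fin n) ℝ) (hKs : K.IsSymm) (hKr : K.rank = n)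
    (hΦI : Φ 1 = embedBlock n m K) :
    ∀ A : Matrix (Fin n) (Fin n) ℝ, A.IsSymm →
      ∃ A₁ : Matrix (Fin n) (Fin n) ℝ, A₁.IsSymm ∧ Φ A = embedBlock n m A₁ := by
  intro A hA
  have hH : A.IsHermitian := by
    rw [Matrix.IsHermitian, Matrix.conjTranspose_eq_transpose_of_trivial]; exact hA
  set V : Matrix (Fin n) (Fin n) ℝ := (hH.eigenvectorUnitary : Matrix (Fin n) (Fin n) ℝ) with hV
  have hVV : V * Vᵀ = 1 := by
    have := Unitary.coe_mul_star_self hH.eigenvectorUnitary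
    rw [Unitary.coe_star, Matrix.star_eq_conjTranspose, Matrix.conjTranspose_eq_transpose_of_trivial] at this
    exact this
  have hAe : A = V * Matrix.diagonal hH.eigenvalues * Vᵀ := by
    have := hH.spectral_theorem
    rw [Unitary.conjStarAlgAut_apply] at this
    rw [Matrix.star_eq_conjTranspose, Matrix.conjTranspose_eq_transpose_of_trivial] at this
    exact this
  have hDs : ∀ l : Fin n → ℝ, (V * Matrix.diagonal l * Vᵀ).IsSymm := by
    intro l
    simp [Matrix.IsSymm, Matrix.transpose_mul, Matrix.mul_assoc]
  have key := diag_core (fun l => Φ (V * Matrix.diagonal l * Vᵀ)) (fun l => hΦsym _ (hDs l))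
    (by simp [hΦ0])
    (by
      have : Matrix.diagonal (1 : Fin n → ℝ) = 1 := Matrix.diagonal_one
      simp only [this, Matrix.mul_one, hVV, hΦI]
      rw [rank_embedBlock n m hnm, hKr])
    (by
      intro l i s t hst
      refine hΦadj _ _ (hDs _) (hDs _) ?_
      rw [← Matrix.sub_mul, ← Matrix.mul_sub, Matrix.diagonal_sub]
      have : (fun j => Function.update l i s j - Function.update l i t j) =
          Pi.single i (s - t) := by
        ext j
        by_cases hj : j = i
        · subst hj; simp
        · simp [hj]
      rw [this]
      exact rank_conj_diag V Vᵀ hVV i _ (sub_ne_zero.2 hst))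
    hH.eigenvalues
  have h1d : Matrix.diagonal (1 : Fin n → ℝ) = 1 := Matrix.diagonal_one
  simp only [h1d, Matrix.mul_one, hVV, hΦI, ← hAe] at key
  have hs := hΦsym A hA
  have hcol : ∀ i j : Fin m, ¬ (j : ℕ) < n → Φ A i j = 0 := by
    intro i j hj
    have : Pi.single j (1 : ℝ) ∈ LinearMap.ker (embedBlock n m K).mulVecLin := by
      simp only [LinearMap.mem_ker, Matrix.mulVecLin_apply, Matrix.mulVec_single_one]
      ext i
      simp [embedBlock, hj]
    have h2 := key this
    simp only [LinearMap.mem_ker, Matrix.mulVecLin_apply, Matrix.mulVec_single_one] at h2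
    exact congrFun h2 i
  refine ⟨(Φ A).submatrix (Fin.castLE hnm.le) (Fin.castLE hnm.le), hs.submatrix _, ?_⟩
  ext i j
  simp only [embedBlock, Matrix.of_apply, Matrix.submatrix_apply]
  split_ifs with hi hj
  · rfl
  · exact hcol i j hj
  · rw [← hs.apply]; exact hcol j i hi
end

section
/- Let m ≥ 1 and let Φ : S_2 → S_m be a map preserving adjacency with Φ(0) = 0. Then either (i) there exist a rank-one matrix B ∈ S_m and a function f : S_2 → ℝ such that Φ(A) = f(A)·B for all A ∈ S_2, or (ii) there exist c ∈ {−1, 1} and an invertible matrix R ∈ M_m(ℝ) such that Φ(A) = c·R·[[A,0],[0,0]]·Rᵀ for all A ∈ S_2, where [[A,0],[0,0]] denotes the m×m block matrix with A in the upper-left 2×2 corner and zeros elsewhere. -/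
open Matrix

namespace AdjN2

/-- Minkowski quadratic form on triples (x,y,z) representing symmetric 2x2 matrices. -/
def q (A : ℝ × ℝ × ℝ) : ℝ := A.1 * A.2.2 - A.2.1 ^ 2

/-- The polar form. -/
def bf (A B : ℝ × ℝ × ℝ) : ℝ := A.1 * B.2.2 + A.2.2 * B.1 - 2 * A.2.1 * B.2.1

lemma q_sub (A B : ℝ × ℝ × ℝ) : q (A - B) = q A + q B - bf A B := by
  simp only [q, bf, Prod.fst_sub, Prod.snd_sub]; ring

lemma bf_comm (A B : ℝ × ℝ × ℝ) : bf A B = bf B A := by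
  simp only [bf]; ring

lemma bf_add (A B C : ℝ × ℝ × ℝ) : bf A (B + C) = bf A B + bf A C := by
  simp only [bf, Prod.fst_add, Prod.snd_add]; ring

lemma bf_smul (c : ℝ) (A B : ℝ × ℝ × ℝ) : bf A (c • B) = c * bf A B := by
  simp only [bf, Prod.smul_fst, Prod.smul_snd, smul_eq_mul]; ring

lemma bf_sub_left (A B C : ℝ × ℝ × ℝ) : bf (A - B) C = bf A C - bf B C := by
  simp only [bf, Prod.fst_sub, Prod.snd_sub]; ring

lemma bf_smul_left (c : ℝ) (A B : ℝ × ℝ × ℝ) : bf (c • A) B = c * bf A B := by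
  simp only [bf, Prod.smul_fst, Prod.smul_snd, smul_eq_mul]; ring

lemma q_smul (c : ℝ) (A : ℝ × ℝ × ℝ) : q (c • A) = c ^ 2 * q A := by
  simp only [q, Prod.smul_fst, Prod.smul_snd, smul_eq_mul]; ring

lemma bf_zero (A : ℝ × ℝ × ℝ) : bf A 0 = 0 := by
  simp [bf]

lemma bf_self (A : ℝ × ℝ × ℝ) : bf A A = 2 * q A := by
  simp only [bf, q]; ring

lemma q_zero : q 0 = 0 := by simp [q]

lemma null_param (a : ℝ × ℝ × ℝ) (h : q a = 0) :
    ∃ c p r : ℝ, a = (c * p ^ 2, c * (p * r), c * r ^ 2) := by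
  obtain ⟨x, y, z⟩ := a
  simp only [q] at h
  by_cases hx : x = 0
  · subst hx
    have hy : y = 0 := by
      have : y ^ 2 = 0 := by linarith
      exact pow_eq_zero_iff (two_ne_zero) |>.1 this
    subst hy
    exact ⟨z, 0, 1, by simp⟩
  · refine ⟨1 / x, x, y, ?_⟩
    have hz : z = y ^ 2 / x := by field_simp; linarith
    ext
    · simp; field_simp
    · simp; field_simp
    · simp [hz]; field_simp

lemma null_par (a b : ℝ × ℝ × ℝ) (ha : q a = 0) (hb : q b = 0) (ha0 : a ≠ 0)
    (hab : bf a b = 0) : ∃ c : ℝ, b = c • a := by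
  obtain ⟨a1, a2, a3⟩ := a
  obtain ⟨b1, b2, b3⟩ := b
  simp only [q, bf] at ha hb hab
  by_cases h1 : a1 = 0
  · subst h1
    have h2 : a2 = 0 := by
      have : a2 ^ 2 = 0 := by linarith
      exact pow_eq_zero_iff (two_ne_zero) |>.1 this
    subst h2
    have h3 : a3 ≠ 0 := by
      rintro rfl; exact ha0 rfl
    have hb1 : b1 = 0 := by
      have : a3 * b1 = 0 := by linarith
      exact (mul_eq_zero.1 this).resolve_left h3
    subst hb1
    have hb2 : b2 = 0 := by
      have : b2 ^ 2 = 0 := by linarith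
      exact pow_eq_zero_iff (two_ne_zero) |>.1 this
    subst hb2
    refine ⟨b3 / a3, ?_⟩
    ext
    · simp
    · simp
    · simp; field_simp
  · have e1 : a1 * b2 = a2 * b1 := by
      have : (a1 * b2 - a2 * b1) ^ 2 = 0 := by
        linear_combination (-b1 ^ 2) * ha - a1 ^ 2 * hb + a1 * b1 * hab
      have := pow_eq_zero_iff (two_ne_zero) |>.1 this
      linarith
    have e2 : a1 * b3 = a3 * b1 := by
      have : a1 * (a1 * b3 - a3 * b1) = 0 := by
        linear_combination a1 * hab + 2 * a2 * e1 - 2 * b1 * ha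
      have := (mul_eq_zero.1 this).resolve_left h1
      linarith
    refine ⟨b1 / a1, ?_⟩
    ext
    · simp; field_simp
    · simp; field_simp; linarith
    · simp; field_simp; linarith

lemma tri_nonneg (a b c : ℝ × ℝ × ℝ) (ha : q a = 0) (hb : q b = 0) (hc : q c = 0) :
    0 ≤ bf a b * bf a c * bf b c := by
  obtain ⟨x, p, r, rfl⟩ := null_param a ha
  obtain ⟨x', p', r', rfl⟩ := null_param b hb
  obtain ⟨x'', p'', r'', rfl⟩ := null_param c hc
  have : bf (x * p ^ 2, x * (p * r), x * r ^ 2) (x' * p' ^ 2, x' * (p' * r'), x' * r' ^ 2) *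
      bf (x * p ^ 2, x * (p * r), x * r ^ 2) (x'' * p'' ^ 2, x'' * (p'' * r''), x'' * r'' ^ 2) *
      bf (x' * p' ^ 2, x' * (p' * r'), x' * r' ^ 2)
        (x'' * p'' ^ 2, x'' * (p'' * r''), x'' * r'' ^ 2) =
      (x * x' * x'' * (p * r' - p' * r) * (p * r'' - p'' * r) * (p' * r'' - p'' * r')) ^ 2 := by
    simp only [bf]; ring
  rw [this]; positivity

lemma indep3 (a b c : ℝ × ℝ × ℝ) (ha : q a = 0) (hb : q b = 0) (hc : q c = 0)
    (hab : bf a b ≠ 0) (hac : bf a c ≠ 0) (hbc : bf b c ≠ 0) (x y z : ℝ)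
    (h : x • a + y • b + z • c = 0) : x = 0 ∧ y = 0 ∧ z = 0 := by
  have key : ∀ d, x * bf d a + y * bf d b + z * bf d c = 0 := by
    intro d
    rw [← bf_smul, ← bf_smul, ← bf_smul, ← bf_add, ← bf_add, h, bf_zero]
  have h1 := key a
  have h2 := key b
  have h3 := key c
  rw [bf_self, ha] at h1
  rw [bf_self, hb, bf_comm b a] at h2
  rw [bf_self, hc, bf_comm c a, bf_comm c b] at h3
  have hz : z = 0 := by
    have : 2 * z * (bf a c * bf b c) = 0 := by
      linear_combination bf b c * h1 + bf a c * h2 - bf a b * h3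
    have := (mul_eq_zero.1 this).resolve_right (mul_ne_zero hac hbc)
    linarith
  subst hz
  refine ⟨?_, ?_, rfl⟩
  · have : x * bf a b = 0 := by linarith
    exact (mul_eq_zero.1 this).resolve_right hab
  · have : y * bf a b = 0 := by linarith
    exact (mul_eq_zero.1 this).resolve_right hab

lemma rel4 (a b c d : ℝ × ℝ × ℝ) (ha : q a = 0) (hb : q b = 0) (hc : q c = 0) (hd : q d = 0)
    (hab : bf a b ≠ 0) (hac : bf a c ≠ 0) (had : bf a d ≠ 0) (hbc : bf b c ≠ 0)
    (hbd : bf b d ≠ 0) (hcd : bf c d ≠ 0) :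
    ∃ x y z w : ℝ, x ≠ 0 ∧ y ≠ 0 ∧ z ≠ 0 ∧ w ≠ 0 ∧ x • a + y • b + z • c + w • d = 0 := by
  obtain ⟨g, hg, i, hi⟩ : ∃ g : Fin 4 → ℝ, ∑ i, g i • (![a, b, c, d] i) = 0 ∧ ∃ i, g i ≠ 0 := by
    have : ¬ LinearIndependent ℝ ![a, b, c, d] := by
      intro hl
      have := hl.fintype_card_le_finrank
      simp at this
    simpa using Fintype.not_linearIndependent_iff.1 this
  simp only [Fin.sum_univ_four] at hg
  simp at hg
  have h0 : ¬ (g 0 = 0 ∧ g 1 = 0 ∧ g 2 = 0 ∧ g 3 = 0) := by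
    rintro ⟨h0, h1, h2, h3⟩
    fin_cases i <;> simp_all
  refine ⟨g 0, g 1, g 2, g 3, ?_, ?_, ?_, ?_, hg⟩
  · intro h; apply h0
    have := indep3 b c d hb hc hd hbc hbd hcd (g 1) (g 2) (g 3) (by rw [← hg, h]; simp)
    tauto
  · intro h; apply h0
    have := indep3 a c d ha hc hd hac had hcd (g 0) (g 2) (g 3) (by rw [← hg, h]; simp)
    tauto
  · intro h; apply h0
    have := indep3 a b d ha hb hd hab had hbd (g 0) (g 1) (g 3) (by rw [← hg, h]; simp)
    tauto
  · intro h; apply h0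
    have := indep3 a b c ha hb hc hab hac hbc (g 0) (g 1) (g 2) (by rw [← hg, h]; simp)
    tauto

lemma pex2 (f g : ℝ → ℝ)
    (h : ∀ x z x' z' : ℝ, x ≠ 0 → z ≠ 0 → x' ≠ 0 → z' ≠ 0 → x + z = x' + z' →
      f z + g x = f z' + g x') :
    ∃ G : ℝ → ℝ, (∀ s t, G (s + t) = G s + G t) ∧ ∃ C C' : ℝ, ∀ a, a ≠ 0 →
      f a = G a + C ∧ g a = G a + C' := by
  obtain ⟨S, hS⟩ : ∃ S : ℝ → ℝ, ∀ x z, x ≠ 0 → z ≠ 0 → f z + g x = S (x + z) := by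
    refine ⟨fun w => if w = 0 then f 1 + g (-1) else f (w / 2) + g (w / 2), ?_⟩
    intro x z hx hz
    by_cases hw : x + z = 0
    · simp only [hw, if_true]
      exact h _ _ _ _ hx hz (by norm_num) (by norm_num) (by linarith)
    · simp only [hw, if_false]
      have : (x + z) / 2 ≠ 0 := by simpa using hw
      exact h _ _ _ _ hx hz this this (by ring)
  have hadd : ∀ s t, S (s + t) - S 0 = (S s - S 0) + (S t - S 0) := by
    intro s t
    have hs := abs_nonneg s
    have ht := abs_nonneg t
    have hs1 := le_abs_self s
    have ht1 := neg_abs_le t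
    have h1 : |s| + |t| + 1 ≠ 0 := by positivity
    have h2 : t + (|s| + |t| + 1) ≠ 0 := by
      have : 0 < t + (|s| + |t| + 1) := by linarith
      exact this.ne'
    have h3 : s - (|s| + |t| + 1) ≠ 0 := by
      have : s - (|s| + |t| + 1) < 0 := by linarith
      exact this.ne
    have h4 : -(|s| + |t| + 1) ≠ 0 := neg_ne_zero.2 h1
    have e1 := hS _ _ h3 h2
    have e2 := hS _ _ h3 h1
    have e3 := hS _ _ h4 h2
    have e4 := hS _ _ h4 h1
    rw [show s - (|s| + |t| + 1) + (t + (|s| + |t| + 1)) = s + t by ring] at e1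
    rw [show s - (|s| + |t| + 1) + (|s| + |t| + 1) = s by ring] at e2
    rw [show -(|s| + |t| + 1) + (t + (|s| + |t| + 1)) = t by ring] at e3
    rw [show -(|s| + |t| + 1) + (|s| + |t| + 1) = 0 by ring] at e4
    linarith
  refine ⟨fun t => S t - S 0, hadd, f 1 - (S 1 - S 0), g 1 - (S 1 - S 0), ?_⟩
  intro a ha
  have e1 := hS 1 a one_ne_zero ha
  have e2 := hS 1 1 one_ne_zero one_ne_zero
  have e3 := hS a 1 ha one_ne_zero
  have e4 := hadd 1 a
  have e5 := hadd 1 1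
  have e6 : S (a + 1) = S (1 + a) := by rw [add_comm]
  constructor <;> simp only <;> linarith

lemma additive_linear (G : ℝ → ℝ) (hG : ∀ s t, G (s + t) = G s + G t) (κ : ℝ) (hκ : κ ≠ 0)
    (hpos : ∀ x, 0 < x → 0 ≤ κ * G x) (x : ℝ) : G x = G 1 * x := by
  let F : ℝ →+ ℝ := AddMonoidHom.mk' (fun x => κ * G x) (by intro a b; simp only [hG]; ring)
  have hF : ∀ x, F x = κ * G x := fun x => rfl
  have hmono : ∀ x y, x ≤ y → F x ≤ F y := by
    intro x y hxy
    rcases hxy.eq_or_lt with rfl | hlt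
    · exact le_rfl
    · have h1 := hpos (y - x) (by linarith)
      rw [← hF, map_sub] at h1
      linarith
  have hrat : ∀ r : ℚ, F (r : ℝ) = r * F 1 := by
    intro r
    have := map_rat_smul F r (1 : ℝ)
    simpa [Rat.smul_def] using this
  have h1 : 0 ≤ F 1 := hpos 1 one_pos
  have hlin : F x = F 1 * x := by
    rcases h1.eq_or_lt with h0 | h0
    · obtain ⟨r, hr⟩ := exists_rat_gt x
      obtain ⟨r', hr'⟩ := exists_rat_lt x
      have a1 := hmono _ _ hr.le
      have a2 := hmono _ _ hr'.le
      rw [hrat, ← h0] at a1 a2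
      rw [← h0]; linarith
    · rcases lt_trichotomy (F x) (F 1 * x) with hlt | heq | hgt
      · have : F x / F 1 < x := by rw [div_lt_iff₀ h0]; linarith
        obtain ⟨r, hr1, hr2⟩ := exists_rat_btwn this
        have a1 := hmono _ _ hr2.le
        rw [hrat] at a1
        rw [div_lt_iff₀ h0] at hr1
        linarith
      · exact heq
      · have : x < F x / F 1 := by rw [lt_div_iff₀ h0]; linarith
        obtain ⟨r, hr1, hr2⟩ := exists_rat_btwn this
        have a1 := hmono _ _ hr1.le
        rw [hrat] at a1
        rw [lt_div_iff₀ h0] at hr2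
        linarith
  rw [hF, hF] at hlin
  exact mul_left_cancel₀ hκ (by linarith)

/-- Injective light-cone preserving map of the 3-space. -/
structure Hyp (ψ : ℝ × ℝ × ℝ → ℝ × ℝ × ℝ) : Prop where
  zero : ψ 0 = 0
  iff : ∀ A B, q (ψ A - ψ B) = 0 ↔ q (A - B) = 0
  inj : ∀ A B, ψ A = ψ B → A = B

lemma Hyp.shift {ψ : ℝ × ℝ × ℝ → ℝ × ℝ × ℝ} (h : Hyp ψ) (B : ℝ × ℝ × ℝ) :
    Hyp (fun A => ψ (B + A) - ψ B) where
  zero := by simp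
  iff := by
    intro A C
    rw [show ψ (B + A) - ψ B - (ψ (B + C) - ψ B) = ψ (B + A) - ψ (B + C) by abel, h.iff]
    rw [show B + A - (B + C) = A - C by abel]
  inj := by
    intro A C hAC
    have := h.inj (B + A) (B + C) (by simpa using hAC)
    simpa using this

lemma Hyp.q_iff {ψ : ℝ × ℝ × ℝ → ℝ × ℝ × ℝ} (h : Hyp ψ) (A : ℝ × ℝ × ℝ) :
    q (ψ A) = 0 ↔ q A = 0 := by
  have := h.iff A 0
  simpa [h.zero] using this

lemma Hyp.rho {ψ : ℝ × ℝ × ℝ → ℝ × ℝ × ℝ} (h : Hyp ψ) (n : ℝ × ℝ × ℝ) (hn : q n = 0)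
    (hn0 : n ≠ 0) : ∃ ρ : ℝ → ℝ, ρ 1 = 1 ∧ (∀ s, ψ (s • n) = ρ s • ψ n) ∧
      (∀ s, s ≠ 0 → ρ s ≠ 0) ∧ (∀ s t, ρ s = ρ t → s = t) := by
  have hd : q (ψ n) = 0 := (h.q_iff n).2 hn
  have hd0 : ψ n ≠ 0 := fun h0 => hn0 (h.inj _ _ (by rw [h0, h.zero]))
  have key : ∀ s : ℝ, ∃ c : ℝ, ψ (s • n) = c • ψ n := by
    intro s
    have h1 : q (ψ (s • n)) = 0 := (h.q_iff _).2 (by rw [q_smul, hn]; simp)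
    have h2 : q (ψ (s • n) - ψ n) = 0 := (h.iff _ _).2 (by
      rw [show s • n - n = (s - 1) • n by module, q_smul, hn]; simp)
    rw [q_sub, h1, hd] at h2
    refine null_par _ _ hd h1 hd0 ?_
    rw [bf_comm]; linarith
  choose ρ hρ using key
  have hinj : ∀ s t, ρ s = ρ t → s = t := by
    intro s t hst
    have := h.inj (s • n) (t • n) (by rw [hρ, hρ, hst])
    exact smul_left_injective ℝ hn0 this
  refine ⟨ρ, ?_, hρ, ?_, hinj⟩
  · have h1 := hρ 1
    rw [one_smul] at h1
    exact smul_left_injective ℝ hd0 (by simpa using h1.symm)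
  · intro s hs hs0
    have h0 := hρ 0
    rw [zero_smul, h.zero] at h0
    have h00 : ρ 0 = 0 := by
      rcases smul_eq_zero.1 h0.symm with h' | h'
      · exact h'
      · exact absurd h' hd0
    exact hs (hinj s 0 (by rw [hs0, h00]))

/-- inversion -/
noncomputable def σ (A : ℝ × ℝ × ℝ) : ℝ × ℝ × ℝ := (1 / q A) • A

lemma q_σ_sub (A B : ℝ × ℝ × ℝ) (hA : q A ≠ 0) (hB : q B ≠ 0) :
    q (σ A - σ B) = q (A - B) / (q A * q B) := by
  rw [q_sub, q_sub, σ, σ, bf_smul, bf_smul_left, q_smul, q_smul]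
  field_simp
  ring

lemma q_σ (A : ℝ × ℝ × ℝ) (hA : q A ≠ 0) : q (σ A) = 1 / q A := by
  rw [σ, q_smul]; field_simp

lemma Hyp.theta {ψ : ℝ × ℝ × ℝ → ℝ × ℝ × ℝ} (h : Hyp ψ) (n : ℝ × ℝ × ℝ) (hn : q n = 0)
    (ρ : ℝ → ℝ) (hρ : ∀ s, ψ (s • n) = ρ s • ψ n) (hρ0 : ∀ s, s ≠ 0 → ρ s ≠ 0)
    (A : ℝ × ℝ × ℝ) (hA : q A ≠ 0) (hAn : bf A n ≠ 0) :
    bf (σ (ψ (σ A))) (ψ n) = 1 / ρ (1 / bf A n) := by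
  have hr := hρ0 (1 / bf A n) (by simpa using hAn)
  have h1 : q (σ A - (1 / bf A n) • n) = 0 := by
    rw [q_sub, q_σ A hA, q_smul, hn, bf_smul, σ, bf_smul_left]
    field_simp; ring
  have h2 := (h.iff _ _).2 h1
  have hX : q (ψ (σ A)) ≠ 0 := by
    rw [Ne, h.q_iff, q_σ A hA]; simpa using hA
  rw [hρ, q_sub, q_smul, (h.q_iff n).2 hn, bf_smul] at h2
  rw [σ, bf_smul_left]
  field_simp
  linarith

/-- three-parameter functional equation, reduced to pairs -/
lemma pex4 (H1 H2 H3 H4 : ℝ → ℝ)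
    (h : ∀ x y z : ℝ, x ≠ 0 → z ≠ 0 → x + z - 2 * y ≠ 0 → x + z + 2 * y ≠ 0 →
      x * z - y ^ 2 ≠ 0 → H1 z + H2 x + H3 (x + z - 2 * y) + H4 (x + z + 2 * y) = 0) :
    (∀ x z x' z' : ℝ, x ≠ 0 → z ≠ 0 → x' ≠ 0 → z' ≠ 0 → x + z = x' + z' →
      H1 z + H2 x = H1 z' + H2 x') ∧
    (∀ u v : ℝ, u ≠ 0 → v ≠ 0 → ∃ x z : ℝ, x ≠ 0 ∧ z ≠ 0 ∧ x + z = (u + v) / 2 ∧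
      H1 z + H2 x + H3 u + H4 v = 0) := by
  constructor
  · intro x z x' z' hx hz hx' hz' hs
    obtain ⟨y, hy⟩ : ∃ y, y = |x| + |z| + |x'| + |z'| + 1 := ⟨_, rfl⟩
    have a1 := abs_nonneg x
    have a2 := abs_nonneg z
    have a3 := abs_nonneg x'
    have a4 := abs_nonneg z'
    have b1 := le_abs_self x
    have b2 := le_abs_self z
    have c1 := neg_abs_le x
    have c2 := neg_abs_le z
    have n1 : x + z - 2 * y ≠ 0 := by
      have : x + z - 2 * y < 0 := by linarith
      exact this.ne
    have n2 : x + z + 2 * y ≠ 0 := by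
      have : 0 < x + z + 2 * y := by linarith
      exact this.ne'
    have n3 : x * z - y ^ 2 ≠ 0 := by
      have h1 : x * z ≤ |x| * |z| := by rw [← abs_mul]; exact le_abs_self _
      have : x * z - y ^ 2 < 0 := by nlinarith
      exact this.ne
    have n4 : x' * z' - y ^ 2 ≠ 0 := by
      have h1 : x' * z' ≤ |x'| * |z'| := by rw [← abs_mul]; exact le_abs_self _
      have : x' * z' - y ^ 2 < 0 := by nlinarith
      exact this.ne
    have e1 := h x y z hx hz n1 n2 n3
    have e2 := h x' y z' hx' hz' (by rw [← hs]; exact n1) (by rw [← hs]; exact n2) n4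
    rw [← hs] at e2
    linarith
  · intro u v hu hv
    obtain ⟨w, hw⟩ : ∃ w, w = (u + v) / 2 := ⟨_, rfl⟩
    have a1 := abs_nonneg w
    have b1 := le_abs_self w
    have c1 := neg_abs_le w
    have p1 : 0 < w / 2 + (|w| + 1) := by linarith
    have p2 : w / 2 - (|w| + 1) < 0 := by linarith
    refine ⟨w / 2 + (|w| + 1), w / 2 - (|w| + 1), p1.ne', p2.ne, by rw [← hw]; ring, ?_⟩
    have e := h (w / 2 + (|w| + 1)) ((v - u) / 4) (w / 2 - (|w| + 1)) p1.ne' p2.ne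
    rw [show w / 2 + (|w| + 1) + (w / 2 - (|w| + 1)) - 2 * ((v - u) / 4) = u by
      rw [hw]; ring, show w / 2 + (|w| + 1) + (w / 2 - (|w| + 1)) + 2 * ((v - u) / 4) = v by
      rw [hw]; ring] at e
    refine e hu hv ?_
    have : (w / 2 + (|w| + 1)) * (w / 2 - (|w| + 1)) < 0 := mul_neg_of_pos_of_neg p1 p2
    have h2 := sq_nonneg ((v - u) / 4)
    have : (w / 2 + (|w| + 1)) * (w / 2 - (|w| + 1)) - ((v - u) / 4) ^ 2 < 0 := by linarith
    exact this.ne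

lemma rho_id (ρ : ℝ → ℝ) (h1 : ρ 1 = 1) (h0 : ∀ s, s ≠ 0 → ρ s ≠ 0) (k γ C : ℝ) (hk : k ≠ 0)
    (hγ : γ ≠ 0) (h : ∀ a, a ≠ 0 → k * (1 / ρ (1 / a)) = γ * a + C) :
    C = 0 ∧ ∀ s, s ≠ 0 → ρ s = s := by
  have hC : C = 0 := by
    by_contra hC
    have ha : -C / γ ≠ 0 := by
      rw [neg_div]; exact neg_ne_zero.2 (div_ne_zero hC hγ)
    have e := h _ ha
    have e2 : γ * (-C / γ) + C = 0 := by field_simp; ring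
    rw [e2] at e
    have := h0 (1 / (-C / γ)) (one_div_ne_zero ha)
    exact mul_ne_zero hk (one_div_ne_zero this) e
  refine ⟨hC, ?_⟩
  subst hC
  have e1 := h 1 one_ne_zero
  simp only [div_one, h1, mul_one, add_zero] at e1
  intro s hs
  have e := h (1 / s) (one_div_ne_zero hs)
  rw [one_div_one_div] at e
  have := h0 s hs
  rw [e1] at e
  field_simp at e
  have e' : γ * (s - ρ s) = 0 := by linear_combination e
  have := (mul_eq_zero.1 e').resolve_left hγ
  linarith

lemma Hyp.line {ψ : ℝ × ℝ × ℝ → ℝ × ℝ × ℝ} (h : Hyp ψ) :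
    (∀ s : ℝ, ψ (s • (1, 0, 0)) = s • ψ (1, 0, 0)) ∧
    (∀ s : ℝ, ψ (s • (0, 0, 1)) = s • ψ (0, 0, 1)) ∧
    (∀ s : ℝ, ψ (s • (1, 1, 1)) = s • ψ (1, 1, 1)) := by
  have q1 : q (1, 0, 0) = 0 := by norm_num [q]
  have q2 : q (0, 0, 1) = 0 := by norm_num [q]
  have q3 : q (1, 1, 1) = 0 := by norm_num [q]
  have q4 : q (1, -1, 1) = 0 := by norm_num [q]
  obtain ⟨ρ1, r11, r1, r10, r1i⟩ := h.rho (1, 0, 0) q1 (by simp)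
  obtain ⟨ρ2, r21, r2, r20, r2i⟩ := h.rho (0, 0, 1) q2 (by simp)
  obtain ⟨ρ3, r31, r3, r30, r3i⟩ := h.rho (1, 1, 1) q3 (by simp)
  obtain ⟨ρ4, r41, r4, r40, r4i⟩ := h.rho (1, -1, 1) q4 (by simp)
  have d1 := (h.q_iff _).2 q1
  have d2 := (h.q_iff _).2 q2
  have d3 := (h.q_iff _).2 q3
  have d4 := (h.q_iff _).2 q4
  have hb : ∀ n n' : ℝ × ℝ × ℝ, q n = 0 → q n' = 0 → bf n n' ≠ 0 → bf (ψ n) (ψ n') ≠ 0 := by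
    intro n n' hn hn' hb hb'
    have := (h.iff n n').1 (by rw [q_sub, (h.q_iff _).2 hn, (h.q_iff _).2 hn', hb']; simp)
    rw [q_sub, hn, hn'] at this
    exact hb (by linarith)
  have b12 := hb _ _ q1 q2 (by norm_num [bf])
  obtain ⟨k1, k2, k3, k4, hk1, hk2, hk3, hk4, hk⟩ := rel4 _ _ _ _ d1 d2 d3 d4
    b12 (hb _ _ q1 q3 (by norm_num [bf])) (hb _ _ q1 q4 (by norm_num [bf]))
    (hb _ _ q2 q3 (by norm_num [bf])) (hb _ _ q2 q4 (by norm_num [bf]))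
    (hb _ _ q3 q4 (by norm_num [bf]))
  have t1 := h.theta _ q1 ρ1 r1 r10
  have t2 := h.theta _ q2 ρ2 r2 r20
  have t3 := h.theta _ q3 ρ3 r3 r30
  have t4 := h.theta _ q4 ρ4 r4 r40
  have n1 : ∀ x y z : ℝ, bf (x, y, z) (1, 0, 0) = z := by intros; simp [bf]
  have n2 : ∀ x y z : ℝ, bf (x, y, z) (0, 0, 1) = x := by intros; simp [bf]
  have n3 : ∀ x y z : ℝ, bf (x, y, z) (1, 1, 1) = x + z - 2 * y := by intros; simp [bf]
  have n4 : ∀ x y z : ℝ, bf (x, y, z) (1, -1, 1) = x + z + 2 * y := by intros; simp [bf]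
  obtain ⟨P, Q⟩ := pex4 (fun a => k1 * (1 / ρ1 (1 / a))) (fun a => k2 * (1 / ρ2 (1 / a)))
    (fun a => k3 * (1 / ρ3 (1 / a))) (fun a => k4 * (1 / ρ4 (1 / a))) (by
      intro x y z hx hz hu hv hq
      have hq' : q (x, y, z) ≠ 0 := hq
      have s1 := t1 (x, y, z) hq' (by rwa [n1])
      have s2 := t2 (x, y, z) hq' (by rwa [n2])
      have s3 := t3 (x, y, z) hq' (by rwa [n3])
      have s4 := t4 (x, y, z) hq' (by rwa [n4])
      rw [n1] at s1
      rw [n2] at s2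
      rw [n3] at s3
      rw [n4] at s4
      rw [← s1, ← s2, ← s3, ← s4, ← bf_smul, ← bf_smul, ← bf_smul, ← bf_smul, ← bf_add,
        ← bf_add, ← bf_add, hk, bf_zero])
  obtain ⟨G, hG, C1, C2, hC⟩ := pex2 _ _ P
  have G1 : G 1 ≠ 0 := by
    intro hG1
    have e1 := (hC 1 one_ne_zero).1
    have e2 := (hC 2 two_ne_zero).1
    have e3 := hG 1 1
    rw [one_add_one_eq_two, hG1] at e3
    rw [e3] at e2
    rw [hG1] at e1
    have e4 : k1 * (1 / ρ1 (1 / 1)) = k1 * (1 / ρ1 (1 / 2)) := by linarith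
    have e5 := mul_left_cancel₀ hk1 e4
    have e6 : ρ1 (1 / 1) = ρ1 (1 / 2) := by simpa using e5
    have := r1i _ _ e6
    norm_num at this
  have hpos : ∀ x, 0 < x → 0 ≤ (G 1 / (k1 * k2) * bf (ψ (1, 0, 0)) (ψ (0, 0, 1))) * G x := by
    intro x hx
    have hsq := Real.sq_sqrt hx.le
    have qA : q (1 + x, √x, 2) ≠ 0 := by
      have : 0 < q (1 + x, √x, 2) := by simp only [q]; nlinarith
      exact this.ne'
    have qB : q (1, 0, 1) ≠ 0 := by norm_num [q]
    have z1 : (1 + x) ≠ 0 := by positivity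
    have a1 := t1 _ qA (by rw [n1]; norm_num)
    have a2 := t2 _ qA (by rw [n2]; exact z1)
    have c1 := t1 _ qB (by rw [n1]; norm_num)
    have c2 := t2 _ qB (by rw [n2]; norm_num)
    rw [n1] at a1 c1
    rw [n2] at a2 c2
    have qX : q (ψ (σ (1 + x, √x, 2))) ≠ 0 := by
      rw [Ne, h.q_iff, q_σ _ qA]; exact one_div_ne_zero qA
    have qY : q (ψ (σ (1, 0, 1))) ≠ 0 := by
      rw [Ne, h.q_iff, q_σ _ qB]; exact one_div_ne_zero qB
    have qD : q (σ (ψ (σ (1 + x, √x, 2))) - σ (ψ (σ (1, 0, 1)))) = 0 := by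
      rw [q_σ_sub _ _ qX qY, (h.iff _ _).2, zero_div]
      rw [q_σ_sub _ _ qA qB]
      have : q ((1 + x, √x, 2) - (1, 0, 1)) = 0 := by
        simp only [q, Prod.mk_sub_mk]; rw [sub_zero, hsq]; ring
      rw [this, zero_div]
    have tri := tri_nonneg _ _ _ qD d1 d2
    rw [bf_sub_left, bf_sub_left, a1, a2, c1, c2] at tri
    have e1 := (hC 1 one_ne_zero).1
    have e1' := (hC 1 one_ne_zero).2
    have e2 := (hC 2 two_ne_zero).1
    have e3 := (hC _ z1).2
    have g2 := hG 1 1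
    rw [one_add_one_eq_two] at g2
    have f1 : 1 / ρ1 (1 / 2) - 1 / ρ1 (1 / 1) = G 1 / k1 := by
      rw [eq_div_iff hk1]; linarith
    have f2 : 1 / ρ2 (1 / (1 + x)) - 1 / ρ2 (1 / 1) = G x / k2 := by
      rw [eq_div_iff hk2]; have := hG 1 x; linarith
    rw [f1, f2] at tri
    calc 0 ≤ _ := tri
      _ = _ := by field_simp
  have hlin := additive_linear G hG _ (mul_ne_zero (div_ne_zero G1 (mul_ne_zero hk1 hk2)) b12) hpos
  obtain ⟨C10, i1⟩ := rho_id ρ1 r11 r10 k1 (G 1) C1 hk1 G1 (fun a ha => by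
    rw [(hC a ha).1, hlin a])
  obtain ⟨C20, i2⟩ := rho_id ρ2 r21 r20 k2 (G 1) C2 hk2 G1 (fun a ha => by
    rw [(hC a ha).2, hlin a])
  subst C10
  subst C20
  obtain ⟨C30, i3⟩ := rho_id ρ3 r31 r30 k3 (-(G 1) / 2)
    (-(G 1) / 2 - k4 * (1 / ρ4 (1 / 1))) hk3 (by
      rw [neg_div]; exact neg_ne_zero.2 (div_ne_zero G1 two_ne_zero)) (fun a ha => by
    obtain ⟨x, z, hx, hz, hxz, e⟩ := Q a 1 ha one_ne_zero
    rw [(hC x hx).2, (hC z hz).1, hlin x, hlin z] at e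
    linear_combination e - G 1 * hxz)
  have fin : ∀ (n : ℝ × ℝ × ℝ) (ρ : ℝ → ℝ), (∀ s, ψ (s • n) = ρ s • ψ n) →
      (∀ s, s ≠ 0 → ρ s = s) → ∀ s : ℝ, ψ (s • n) = s • ψ n := by
    intro n ρ hr hi s
    by_cases hs : s = 0
    · simp [hs, h.zero]
    · rw [hr, hi s hs]
  exact ⟨fin _ _ r1 i1, fin _ _ r2 i2, fin _ _ r3 i3⟩

lemma Hyp.para {ψ : ℝ × ℝ × ℝ → ℝ × ℝ × ℝ} (h : Hyp ψ) (n n' : ℝ × ℝ × ℝ)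
    (q1 : q n = 0) (q2 : q n' = 0) (hn : n ≠ 0) (hnn : bf n n' ≠ 0)
    (L1 : ∀ (B : ℝ × ℝ × ℝ) (s : ℝ), ψ (B + s • n) = ψ B + s • (ψ (B + n) - ψ B))
    (L2 : ∀ (B : ℝ × ℝ × ℝ) (s : ℝ), ψ (B + s • n') = ψ B + s • (ψ (B + n') - ψ B))
    (x z : ℝ) :
    ψ (x • n + z • n') = x • ψ n + z • ψ n' := by
  obtain ⟨e, he⟩ : ∃ e, e = ψ (n + n') - ψ n - ψ n' := ⟨_, rfl⟩
  have key : ∀ x z : ℝ, ψ (x • n + z • n') = x • ψ n + z • ψ n' + (x * z) • e := by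
    intro x z
    have a1 := L2 (x • n) z
    have a2 := L1 n' x
    have a3 := L1 0 x
    rw [zero_add, zero_add, h.zero] at a3
    rw [a1, add_comm (x • n) n', a2, a3, he, add_comm n n']
    module
  have hq : ∀ x : ℝ, q (ψ n' + x • e) = 0 := by
    intro x
    have := (h.iff (x • n + (1 : ℝ) • n') (x • n + (0 : ℝ) • n')).2 (by
      rw [show x • n + (1 : ℝ) • n' - (x • n + (0 : ℝ) • n') = n' by module, q2])
    rw [key, key] at this
    rw [← this]; congr 1; module
  have hq' : ∀ z : ℝ, q (ψ n + z • e) = 0 := by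
    intro z
    have := (h.iff ((1 : ℝ) • n + z • n') ((0 : ℝ) • n + z • n')).2 (by
      rw [show (1 : ℝ) • n + z • n' - ((0 : ℝ) • n + z • n') = n by module, q1])
    rw [key, key] at this
    rw [← this]; congr 1; module
  have d1 := (h.q_iff _).2 q1
  have d2 := (h.q_iff _).2 q2
  have qa : ∀ A B : ℝ × ℝ × ℝ, q (A + B) = q A + q B + bf A B := by
    intro A B; simp only [q, bf, Prod.fst_add, Prod.snd_add]; ring
  have p1 := hq 1
  have p2 := hq (-1)
  have p3 := hq' 1
  have p4 := hq' (-1)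
  rw [qa, q_smul, bf_smul, d2] at p1 p2
  rw [qa, q_smul, bf_smul, d1] at p3 p4
  have qe : q e = 0 := by linarith
  have be2 : bf (ψ n') e = 0 := by linarith
  have be1 : bf (ψ n) e = 0 := by linarith
  have ne1 : ψ n ≠ 0 := fun h0 => hn (h.inj _ _ (h0.trans h.zero.symm))
  have b12 : bf (ψ n) (ψ n') ≠ 0 := by
    intro hb'
    have := (h.iff n n').1 (by rw [q_sub, d1, d2, hb']; simp)
    rw [q_sub, q1, q2] at this
    exact hnn (by linarith)
  obtain ⟨c, hc⟩ := null_par _ _ d1 qe ne1 be1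
  rw [hc, bf_smul, bf_comm] at be2
  have c0 := (mul_eq_zero.1 be2).resolve_right b12
  rw [key, hc, c0]; simp

lemma Hyp.lines {ψ : ℝ × ℝ × ℝ → ℝ × ℝ × ℝ} (h : Hyp ψ) (B : ℝ × ℝ × ℝ) (s : ℝ) :
    ψ (B + s • (1, 0, 0)) = ψ B + s • (ψ (B + (1, 0, 0)) - ψ B) ∧
    ψ (B + s • (0, 0, 1)) = ψ B + s • (ψ (B + (0, 0, 1)) - ψ B) ∧
    ψ (B + s • (1, 1, 1)) = ψ B + s • (ψ (B + (1, 1, 1)) - ψ B) := by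
  obtain ⟨a, b, c⟩ := (h.shift B).line
  refine ⟨?_, ?_, ?_⟩
  · rw [← a s]; abel
  · rw [← b s]; abel
  · rw [← c s]; abel

lemma Hyp.linear {ψ : ℝ × ℝ × ℝ → ℝ × ℝ × ℝ} (h : Hyp ψ) (x y z : ℝ) :
    ψ (x, y, z) = x • ψ (1, 0, 0) + z • ψ (0, 0, 1) +
      y • (ψ (1, 1, 1) - ψ (1, 0, 0) - ψ (0, 0, 1)) := by
  have q1 : q (1, 0, 0) = 0 := by norm_num [q]
  have q2 : q (0, 0, 1) = 0 := by norm_num [q]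
  have para12 : ∀ {χ : ℝ × ℝ × ℝ → ℝ × ℝ × ℝ}, Hyp χ → ∀ x z : ℝ,
      χ (x • (1, 0, 0) + z • (0, 0, 1)) = x • χ (1, 0, 0) + z • χ (0, 0, 1) := by
    intro χ hχ
    exact hχ.para (1, 0, 0) (0, 0, 1) q1 q2 (by simp) (by norm_num [bf])
      (fun B s => (hχ.lines B s).1) (fun B s => (hχ.lines B s).2.1)
  have f1 := h.para (1, 0, 0) (1, 1, 1) q1 (by norm_num [q]) (by simp) (by norm_num [bf])
      (fun B s => (h.lines B s).1) (fun B s => (h.lines B s).2.2) 1 1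
  have f2 := h.para (0, 0, 1) (1, 1, 1) q2 (by norm_num [q]) (by simp) (by norm_num [bf])
      (fun B s => (h.lines B s).2.1) (fun B s => (h.lines B s).2.2) 1 1
  have a1 := (h.lines ((x - y) • (1, 0, 0) + (z - y) • (0, 0, 1)) y).2.2
  have a2 := para12 (h.shift (1, 1, 1)) (x - y) (z - y)
  have a3 := para12 h (x - y) (z - y)
  simp only [one_smul] at f1 f2
  rw [sub_eq_iff_eq_add, add_comm (1, 1, 1), add_comm (1, 1, 1), add_comm (1, 1, 1), f1, f2] at a2
  rw [a2, a3] at a1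
  have e : ((x, y, z) : ℝ × ℝ × ℝ) =
      (x - y) • (1, 0, 0) + (z - y) • (0, 0, 1) + y • (1, 1, 1) := by
    ext <;> simp
  rw [e, a1]
  module

section LA
variable {m : ℕ}

/-- rank one symmetric -/
def R1 (M : Matrix (Fin m) (Fin m) ℝ) : Prop :=
  ∃ (c : ℝ) (v : Fin m → ℝ), c ≠ 0 ∧ v ≠ 0 ∧ M = c • vecMulVec v v

/-- independence of two vectors -/
def Ind (u v : Fin m → ℝ) : Prop := ∀ a b : ℝ, a • u + b • v = 0 → a = 0 ∧ b = 0

/-- membership in span -/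
def In2 (u v w : Fin m → ℝ) : Prop := ∃ a b : ℝ, w = a • u + b • v

/-- symmetric tensors on a plane -/
def S (u v : Fin m → ℝ) (X : ℝ × ℝ × ℝ) : Matrix (Fin m) (Fin m) ℝ :=
  X.1 • vecMulVec u u + X.2.1 • (vecMulVec u v + vecMulVec v u) + X.2.2 • vecMulVec v v

lemma Ind.symm {u v : Fin m → ℝ} (h : Ind u v) : Ind v u := by
  intro a b hab
  have := h b a (by rw [add_comm]; exact hab)
  tauto

lemma Ind.left {u v : Fin m → ℝ} (h : Ind u v) : u ≠ 0 := by
  rintro rfl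
  have := h 1 0 (by simp)
  simp at this

lemma Ind.right {u v : Fin m → ℝ} (h : Ind u v) : v ≠ 0 := h.symm.left

lemma not_ind {u v : Fin m → ℝ} (hv : v ≠ 0) (h : ¬ Ind u v) : ∃ k : ℝ, u = k • v := by
  simp only [Ind, not_forall] at h
  obtain ⟨a, b, hab, hn⟩ := h
  have ha : a ≠ 0 := by
    rintro rfl
    rw [zero_smul, zero_add] at hab
    rcases smul_eq_zero.1 hab with h | h
    · exact hn ⟨rfl, h⟩
    · exact hv h
  refine ⟨-b / a, ?_⟩
  have : a • u = (-b) • v := by rw [eq_comm, neg_smul, neg_eq_iff_add_eq_zero, add_comm]; exact hab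
  rw [div_eq_inv_mul, mul_smul, ← this, smul_smul, inv_mul_cancel₀ ha, one_smul]

lemma Ind.dual {u v : Fin m → ℝ} (h : Ind u v) : ∃ f : Fin m → ℝ, u ⬝ᵥ f = 1 ∧ v ⬝ᵥ f = 0 := by
  have hv : v ⬝ᵥ v ≠ 0 := fun h0 => h.right (dotProduct_self_eq_zero.1 h0)
  obtain ⟨x, hx⟩ : ∃ x, x = u - ((u ⬝ᵥ v) / (v ⬝ᵥ v)) • v := ⟨_, rfl⟩
  have hx0 : x ≠ 0 := by
    intro h0
    have := h 1 (-((u ⬝ᵥ v) / (v ⬝ᵥ v))) (by rw [← h0, hx]; module)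
    simp at this
  have hvx : v ⬝ᵥ x = 0 := by
    rw [hx, dotProduct_sub, dotProduct_smul, smul_eq_mul, dotProduct_comm u v]
    field_simp; ring
  have hux : u ⬝ᵥ x = x ⬝ᵥ x := by
    have e : (u - ((u ⬝ᵥ v) / (v ⬝ᵥ v)) • v) ⬝ᵥ x = x ⬝ᵥ x := by rw [← hx]
    rw [sub_dotProduct, smul_dotProduct, hvx] at e
    simpa using e
  have hxx : x ⬝ᵥ x ≠ 0 := fun h0 => hx0 (dotProduct_self_eq_zero.1 h0)
  refine ⟨(x ⬝ᵥ x)⁻¹ • x, ?_, ?_⟩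
  · rw [dotProduct_smul, hux, smul_eq_mul, inv_mul_cancel₀ hxx]
  · rw [dotProduct_smul, hvx]; simp

lemma sq_mulVec (c : ℝ) (v f : Fin m → ℝ) :
    (c • vecMulVec v v) *ᵥ f = (c * (v ⬝ᵥ f)) • v := by
  rw [smul_mulVec, vecMulVec_mulVec, mul_smul]; simp

lemma smul_sq (k : ℝ) (v : Fin m → ℝ) : vecMulVec (k • v) (k • v) = k ^ 2 • vecMulVec v v := by
  ext i j; simp [vecMulVec_apply]; ring

lemma R1.smul {M : Matrix (Fin m) (Fin m) ℝ} (h : R1 M) {k : ℝ} (hk : k ≠ 0) : R1 (k • M) := by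
  obtain ⟨c, v, hc, hv, rfl⟩ := h
  exact ⟨k * c, v, mul_ne_zero hk hc, hv, by rw [smul_smul]⟩

lemma R1.ne {M : Matrix (Fin m) (Fin m) ℝ} (h : R1 M) : M ≠ 0 := by
  obtain ⟨c, v, hc, hv, rfl⟩ := h
  intro h0
  have := sq_mulVec c v v
  rw [h0, zero_mulVec] at this
  have hvv : v ⬝ᵥ v ≠ 0 := fun h0 => hv (dotProduct_self_eq_zero.1 h0)
  rcases smul_eq_zero.1 this.symm with h | h
  · exact mul_ne_zero hc hvv h
  · exact hv h

lemma R1.symm {M : Matrix (Fin m) (Fin m) ℝ} (h : R1 M) : M.IsSymm := by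
  obtain ⟨c, v, hc, hv, rfl⟩ := h
  ext i j; simp [vecMulVec_apply, mul_comm]

lemma R1.rank {M : Matrix (Fin m) (Fin m) ℝ} (h : R1 M) : M.rank = 1 := by
  have h0 := h.ne
  obtain ⟨c, v, hc, hv, rfl⟩ := h
  apply le_antisymm
  · rw [← smul_vecMulVec]; exact rank_vecMulVec_le _ _
  · rw [Nat.one_le_iff_ne_zero]
    intro hr
    apply h0
    rw [Matrix.rank, Submodule.finrank_eq_zero, LinearMap.range_eq_bot] at hr
    ext i j
    have := congrFun (congrArg (fun f => f (Pi.single j 1)) hr) i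
    simpa using this

lemma R1.of_rank {M : Matrix (Fin m) (Fin m) ℝ} (hs : M.IsSymm) (h : M.rank = 1) : R1 M := by
  have hM : M ≠ 0 := by rintro rfl; simp at h
  rw [Matrix.rank, finrank_eq_one_iff'] at h
  obtain ⟨⟨w, hwm⟩, hw, hall⟩ := h
  have hw : w ≠ 0 := fun h0 => hw (by simp [h0])
  have key : ∀ j, ∃ c : ℝ, ∀ i, M i j = c * w i := by
    intro j
    obtain ⟨c, hc⟩ := hall ⟨M.mulVecLin (Pi.single j 1), LinearMap.mem_range_self _ _⟩
    refine ⟨c, fun i => ?_⟩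
    have := congrFun (congrArg Subtype.val hc) i
    simpa using this.symm
  choose c hc using key
  obtain ⟨i0, hi0⟩ : ∃ i, w i ≠ 0 := by
    by_contra hcon
    push Not at hcon
    exact hw (funext hcon)
  have hcj : ∀ j, c j = c i0 / w i0 * w j := by
    intro j
    have := hs.apply i0 j
    rw [hc, hc] at this
    field_simp; linarith
  have hE : M = (c i0 / w i0) • vecMulVec w w := by
    ext i j
    rw [hc, hcj]; simp [vecMulVec_apply]; ring
  refine ⟨c i0 / w i0, w, ?_, hw, hE⟩
  intro h0
  rw [h0, zero_smul] at hE
  exact hM hE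

lemma R1.par {P Q : Matrix (Fin m) (Fin m) ℝ} (hP : R1 P) (hQ : R1 Q) (hPQ : R1 (P - Q)) :
    ∃ k : ℝ, P = k • Q := by
  obtain ⟨c, u, hc, hu, rfl⟩ := hP
  obtain ⟨d, v, hd, hv, rfl⟩ := hQ
  obtain ⟨e, w, he, hw, hE⟩ := hPQ
  by_cases hi : Ind u v
  · exfalso
    obtain ⟨f, hfu, hfv⟩ := hi.dual
    obtain ⟨g, hgv, hgu⟩ := hi.symm.dual
    have e1 := congrArg (fun M => M *ᵥ f) hE
    have e2 := congrArg (fun M => M *ᵥ g) hE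
    simp only [sub_mulVec, sq_mulVec, hfu, hfv, hgu, hgv] at e1 e2
    simp only [mul_one, mul_zero, zero_smul, sub_zero, zero_sub] at e1 e2
    have := hi ((w ⬝ᵥ g) * c) ((w ⬝ᵥ f) * d) (by
      rw [mul_smul, mul_smul, e1, show d • v = -((e * (w ⬝ᵥ g)) • w) by rw [← e2, neg_neg]]
      module)
    have h1 : w ⬝ᵥ g = 0 := (mul_eq_zero.1 this.1).resolve_right hc
    rw [h1, mul_zero, zero_smul, neg_eq_zero] at e2
    rcases smul_eq_zero.1 e2 with h | h
    · exact hd h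
    · exact hv h
  · obtain ⟨k, rfl⟩ := not_ind hv hi
    refine ⟨c * k ^ 2 / d, ?_⟩
    rw [smul_sq, smul_smul, smul_smul]
    congr 1; field_simp

lemma R1.two {B X : Matrix (Fin m) (Fin m) ℝ} (hB : R1 B) (s t : ℝ) (hst : s ≠ t)
    (h1 : R1 (X - s • B)) (h2 : R1 (X - t • B)) : ∃ k : ℝ, X = k • B := by
  obtain ⟨k, hk⟩ := R1.par h1 (hB.smul (sub_ne_zero.2 hst.symm)) (by
    rw [show X - s • B - (t - s) • B = X - t • B by module]; exact h2)
  refine ⟨k * (t - s) + s, ?_⟩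
  rw [sub_eq_iff_eq_add] at hk
  rw [hk]; module

lemma LA1 {z w y y' : Fin m → ℝ} {α β s t : ℝ} (h1 : Ind z w) (h2 : Ind w y') (hβ : β ≠ 0)
    (h : α • vecMulVec z z + s • vecMulVec y y = β • vecMulVec w w + t • vecMulVec y' y') :
    In2 z w y := by
  obtain ⟨x, hx1, hx2⟩ := h2.dual
  have e := congrArg (fun M => M *ᵥ x) h
  simp only [add_mulVec, sq_mulVec, hx1, hx2, mul_one, mul_zero, zero_smul, add_zero] at e
  have hs : s * (y ⬝ᵥ x) ≠ 0 := by
    intro h0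
    rw [h0, zero_smul, add_zero] at e
    have := h1 (α * (z ⬝ᵥ x)) (-β) (by rw [e]; module)
    exact hβ (neg_eq_zero.1 this.2)
  refine ⟨-(α * (z ⬝ᵥ x)) / (s * (y ⬝ᵥ x)), β / (s * (y ⬝ᵥ x)), ?_⟩
  have e' : (s * (y ⬝ᵥ x)) • y = (-(α * (z ⬝ᵥ x))) • z + β • w := by
    rw [← e]; module
  rw [div_eq_inv_mul, div_eq_inv_mul, mul_smul, mul_smul, ← smul_add, ← e', smul_smul,
    inv_mul_cancel₀ hs, one_smul]

lemma LA2 {u v z y : Fin m → ℝ} {α s : ℝ} {X : ℝ × ℝ × ℝ} (h : Ind z y) (hα : α ≠ 0)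
    (hX : α • vecMulVec z z + s • vecMulVec y y = S u v X) : In2 u v z := by
  obtain ⟨x, hx1, hx2⟩ := h.dual
  have e := congrArg (fun M => M *ᵥ x) hX
  simp only [S, add_mulVec, sq_mulVec, hx1, hx2, mul_one, mul_zero, zero_smul, add_zero, one_smul, smul_zero,
    smul_mulVec, vecMulVec_mulVec, op_smul_eq_smul] at e
  refine ⟨α⁻¹ * (X.1 * (u ⬝ᵥ x) + X.2.1 * (v ⬝ᵥ x)),
    α⁻¹ * (X.2.1 * (u ⬝ᵥ x) + X.2.2 * (v ⬝ᵥ x)), ?_⟩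
  rw [mul_smul, mul_smul, ← smul_add, eq_inv_smul_iff₀ hα, e]
  module

lemma S_sq (u v : Fin m → ℝ) (c p r : ℝ) :
    S u v (c * p ^ 2, c * (p * r), c * r ^ 2) = c • vecMulVec (p • u + r • v) (p • u + r • v) := by
  ext i j; simp [S, vecMulVec_apply]; ring

lemma S_add (u v : Fin m → ℝ) (X Y : ℝ × ℝ × ℝ) : S u v (X + Y) = S u v X + S u v Y := by
  simp only [S, Prod.fst_add, Prod.snd_add]; module

lemma S_sub (u v : Fin m → ℝ) (X Y : ℝ × ℝ × ℝ) : S u v (X - Y) = S u v X - S u v Y := by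
  simp only [S, Prod.fst_sub, Prod.snd_sub]; module

lemma S_form (u v a b : Fin m → ℝ) (X : ℝ × ℝ × ℝ) :
    a ⬝ᵥ (S u v X *ᵥ b) = X.1 * ((u ⬝ᵥ a) * (u ⬝ᵥ b)) +
      X.2.1 * ((u ⬝ᵥ a) * (v ⬝ᵥ b) + (v ⬝ᵥ a) * (u ⬝ᵥ b)) + X.2.2 * ((v ⬝ᵥ a) * (v ⬝ᵥ b)) := by
  simp only [S, add_mulVec, smul_mulVec, vecMulVec_mulVec, op_smul_eq_smul, dotProduct_comm a,
    add_dotProduct, smul_dotProduct, smul_eq_mul]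
  ring

lemma Ind.coords {u v : Fin m → ℝ} (h : Ind u v) : ∃ f g : Fin m → ℝ, ∀ X : ℝ × ℝ × ℝ,
    X = (f ⬝ᵥ (S u v X *ᵥ f), f ⬝ᵥ (S u v X *ᵥ g), g ⬝ᵥ (S u v X *ᵥ g)) := by
  obtain ⟨f, hfu, hfv⟩ := h.dual
  obtain ⟨g, hgv, hgu⟩ := h.symm.dual
  refine ⟨f, g, fun X => ?_⟩
  simp [S_form, hfu, hfv, hgu, hgv]

lemma Ind.S_inj {u v : Fin m → ℝ} (h : Ind u v) {X Y : ℝ × ℝ × ℝ} (hXY : S u v X = S u v Y) :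
    X = Y := by
  obtain ⟨f, g, hfg⟩ := h.coords
  rw [hfg X, hfg Y, hXY]

lemma Ind.S_R1 {u v : Fin m → ℝ} (h : Ind u v) {X : ℝ × ℝ × ℝ} (hX : R1 (S u v X)) :
    q X = 0 := by
  obtain ⟨f, g, hfg⟩ := h.coords
  obtain ⟨c, w, hc, hw, hE⟩ := hX
  rw [hfg X, hE]
  simp only [sq_mulVec, smul_dotProduct, smul_eq_mul, q, dotProduct_comm f, dotProduct_comm g]
  ring

lemma Ind.R1_S {u v : Fin m → ℝ} (h : Ind u v) {X : ℝ × ℝ × ℝ} (hX : q X = 0) (hX0 : X ≠ 0) :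
    R1 (S u v X) := by
  obtain ⟨c, p, r, rfl⟩ := null_param X hX
  rw [S_sq]
  refine ⟨c, _, ?_, ?_, rfl⟩
  · rintro rfl; simp at hX0
  · intro h0
    obtain ⟨rfl, rfl⟩ := h p r h0
    simp at hX0

lemma In2.S {u v w : Fin m → ℝ} (h : In2 u v w) (c : ℝ) :
    ∃ X, c • vecMulVec w w = S u v X := by
  obtain ⟨a, b, rfl⟩ := h
  exact ⟨_, (S_sq u v c a b).symm⟩

lemma In2.trans {u v z w y : Fin m → ℝ} (hz : In2 u v z) (hw : In2 u v w) (hy : In2 z w y) :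
    In2 u v y := by
  obtain ⟨a, b, rfl⟩ := hz
  obtain ⟨c, d, rfl⟩ := hw
  obtain ⟨e, f, rfl⟩ := hy
  exact ⟨e * a + f * c, e * b + f * d, by module⟩

end LA

section Deg
variable {m : ℕ}

/-- adjacency preserving -/
def AdjP (φ : ℝ × ℝ × ℝ → Matrix (Fin m) (Fin m) ℝ) : Prop :=
  ∀ A B, A ≠ B → q (A - B) = 0 → R1 (φ A - φ B)

lemma q_sub_comm (A B : ℝ × ℝ × ℝ) : q (A - B) = q (B - A) := by
  simp only [q, Prod.fst_sub, Prod.snd_sub]; ring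

lemma AdjP.ne {φ : ℝ × ℝ × ℝ → Matrix (Fin m) (Fin m) ℝ} (h : AdjP φ) {A B : ℝ × ℝ × ℝ}
    (hAB : A ≠ B) (hq : q (A - B) = 0) : φ A ≠ φ B :=
  sub_ne_zero.1 (h A B hAB hq).ne

lemma AdjP.two {φ : ℝ × ℝ × ℝ → Matrix (Fin m) (Fin m) ℝ} (h : AdjP φ)
    {B : Matrix (Fin m) (Fin m) ℝ} (hB : R1 B) {P Q X : ℝ × ℝ × ℝ} {s t : ℝ} (hP : φ P = s • B)
    (hQ : φ Q = t • B) (hne : s ≠ t) (h1 : q (X - P) = 0) (h2 : q (X - Q) = 0) :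
    ∃ k : ℝ, φ X = k • B := by
  by_cases hXP : X = P
  · exact ⟨s, by rw [hXP, hP]⟩
  by_cases hXQ : X = Q
  · exact ⟨t, by rw [hXQ, hQ]⟩
  exact R1.two hB s t hne (by rw [← hP]; exact h _ _ hXP h1) (by rw [← hQ]; exact h _ _ hXQ h2)

lemma AdjP.deg0 {φ : ℝ × ℝ × ℝ → Matrix (Fin m) (Fin m) ℝ} (h : AdjP φ) (h0 : φ 0 = 0)
    {B : Matrix (Fin m) (Fin m) ℝ} (hB : R1 B) {a0 b0 s0 t0 : ℝ} (ha0 : a0 ≠ 0) (hb0 : b0 ≠ 0)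
    (hs : φ (a0, 0, 0) = s0 • B) (ht : φ (0, 0, b0) = t0 • B) (A : ℝ × ℝ × ℝ) :
    ∃ k : ℝ, φ A = k • B := by
  have h00 : φ (0, 0, 0) = (0 : ℝ) • B := by rw [zero_smul]; exact h0
  have val : ∀ {P Q : ℝ × ℝ × ℝ} {s t : ℝ}, φ P = s • B → φ Q = t • B → P ≠ Q → q (P - Q) = 0 →
      s ≠ t := by
    rintro P Q s t hP hQ hne hq rfl
    exact h.ne hne hq (hP.trans hQ.symm)
  have hx : ∀ a : ℝ, ∃ k : ℝ, φ (a, 0, 0) = k • B := fun a =>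
    h.two hB hs h00 (val hs h00 (by simpa using ha0) (by simp [q])) (by simp [q]) (by simp [q])
  have hz : ∀ b : ℝ, ∃ k : ℝ, φ (0, 0, b) = k • B := fun b =>
    h.two hB ht h00 (val ht h00 (by simpa using hb0) (by simp [q])) (by simp [q]) (by simp [q])
  have hd : ∀ a b : ℝ, ∃ k : ℝ, φ (a, 0, b) = k • B := by
    choose α hα using hx
    choose β hβ using hz
    intro a
    have key : ∀ b, β b ≠ α a → ∃ k : ℝ, φ (a, 0, b) = k • B := fun b hb =>
      h.two hB (hβ b) (hα a) hb (by simp [q]) (by simp [q])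
    have inj : ∀ b b', b ≠ b' → β b ≠ β b' := fun b b' hbb =>
      val (hβ b) (hβ b') (by simpa using hbb) (by simp [q])
    have fin : ∀ b b', b ≠ b' → β b ≠ α a → β b' ≠ α a → ∀ c, ∃ k : ℝ, φ (a, 0, c) = k • B := by
      intro b b' hbb h1 h2 c
      obtain ⟨k, hk⟩ := key b h1
      obtain ⟨l, hl⟩ := key b' h2
      exact h.two hB hk hl (val hk hl (by simpa using hbb) (by simp [q])) (by simp [q])
        (by simp [q])
    by_cases h1 : β 1 = α a
    · have h2 : β 2 ≠ α a := h1 ▸ inj 2 1 (by norm_num)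
      have h3 : β 3 ≠ α a := h1 ▸ inj 3 1 (by norm_num)
      exact fin 2 3 (by norm_num) h2 h3
    · by_cases h2 : β 2 = α a
      · have h3 : β 3 ≠ α a := h2 ▸ inj 3 2 (by norm_num)
        exact fin 1 3 (by norm_num) h1 h3
      · exact fin 1 2 (by norm_num) h1 h2
  obtain ⟨x, y, z⟩ := A
  by_cases hy : y = 0
  · subst hy; exact hd x z
  by_contra hA
  obtain ⟨c, hc⟩ := hd (x - y) (z - y)
  obtain ⟨d, hd1⟩ := hd (x - 2 * y) (z - y / 2)
  obtain ⟨e, he1⟩ := hd (x - 2 * y) (z - y / 3)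
  have hcd : c = d := by
    by_contra hcd
    exact hA (h.two hB hc hd1 hcd (by simp [q]; ring) (by simp [q]; ring))
  have hA' : ¬ ∃ k : ℝ, φ (x + y, 2 * y, z + y) = k • B := by
    rintro ⟨k, hk⟩
    refine hA (h.two hB hc hk (val hc hk ?_ ?_) (by simp [q]; ring) (by simp [q]; ring))
    · intro h'
      simp only [Prod.mk.injEq] at h'
      exact hy (by linarith [h'.2.1])
    · simp [q]; ring
  have hce : c = e := by
    by_contra hce
    refine hA' (h.two hB hc he1 hce (by simp [q]; ring) ?_)
    simp [q]; ring
  refine val hd1 he1 ?_ (by simp [q]) (hcd.symm.trans hce)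
  intro h'
  simp only [Prod.mk.injEq] at h'
  exact hy (by linarith [h'.2.2])

/-- congruence -/
def T (p r s t : ℝ) (A : ℝ × ℝ × ℝ) : ℝ × ℝ × ℝ :=
  (p ^ 2 * A.1 + 2 * p * s * A.2.1 + s ^ 2 * A.2.2,
   p * r * A.1 + (p * t + r * s) * A.2.1 + s * t * A.2.2,
   r ^ 2 * A.1 + 2 * r * t * A.2.1 + t ^ 2 * A.2.2)

lemma T_q (p r s t : ℝ) (A : ℝ × ℝ × ℝ) : q (T p r s t A) = (p * t - r * s) ^ 2 * q A := by
  simp only [T, q]; ring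

lemma T_sub (p r s t : ℝ) (A B : ℝ × ℝ × ℝ) :
    T p r s t (A - B) = T p r s t A - T p r s t B := by
  simp only [T, Prod.fst_sub, Prod.snd_sub, Prod.mk_sub_mk]
  ext <;> simp <;> ring

lemma T_surj (p r s t : ℝ) (hD : p * t - r * s ≠ 0) (A : ℝ × ℝ × ℝ) :
    ∃ A', T p r s t A' = A := by
  refine ⟨(1 / (p * t - r * s) ^ 2) • T t (-r) (-s) p A, ?_⟩
  ext <;> simp [T] <;> field_simp <;> ring

lemma T_inj (p r s t : ℝ) (hD : p * t - r * s ≠ 0) (A : ℝ × ℝ × ℝ) (h : T p r s t A = 0) :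
    A = 0 := by
  have e : A = (1 / (p * t - r * s) ^ 2) • T t (-r) (-s) p (T p r s t A) := by
    ext <;> simp [T] <;> field_simp <;> ring
  rw [e, h]; simp [T]

lemma AdjP.deg {φ : ℝ × ℝ × ℝ → Matrix (Fin m) (Fin m) ℝ} (h : AdjP φ) (h0 : φ 0 = 0)
    {P X Y : ℝ × ℝ × ℝ} {k : ℝ} (hX : q (X - P) = 0) (hY : q (Y - P) = 0) (hXY : q (X - Y) ≠ 0)
    (hk : φ X - φ P = k • (φ Y - φ P)) :
    ∃ B, R1 B ∧ ∀ A, ∃ t : ℝ, φ A = t • B := by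
  obtain ⟨c, p, r, hc⟩ := null_param _ hX
  obtain ⟨d, s, t, hd⟩ := null_param _ hY
  have hq : q (X - Y) = -(c * d * (p * t - r * s) ^ 2) := by
    rw [show X - Y = (X - P) - (Y - P) by abel, hc, hd]
    simp only [q, Prod.mk_sub_mk]; ring
  rw [hq] at hXY
  have hc0 : c ≠ 0 := by rintro rfl; simp at hXY
  have hd0 : d ≠ 0 := by rintro rfl; simp at hXY
  have hD : p * t - r * s ≠ 0 := by intro h0; simp [h0] at hXY
  have hYP : Y ≠ P := by
    rintro rfl
    rw [← hq] at hXY; exact hXY hX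
  have hB : R1 (φ Y - φ P) := h _ _ hYP hY
  have h' : AdjP (fun A => φ (P + T p r s t A) - φ P) := by
    intro A B hAB hqq
    have e : P + T p r s t A - (P + T p r s t B) = T p r s t (A - B) := by
      rw [T_sub]; abel
    have := h (P + T p r s t A) (P + T p r s t B) (by
      intro h1
      rw [h1, sub_self] at e
      exact hAB (sub_eq_zero.1 (T_inj p r s t hD _ e.symm))) (by rw [e, T_q, hqq, mul_zero])
    simpa using this
  have key := h'.deg0 (by rw [show T p r s t 0 = 0 by ext <;> simp [T]]; simp) hB (s0 := k) (t0 := 1) hc0 hd0 (by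
    rw [show T p r s t (c, 0, 0) = X - P by rw [hc]; ext <;> simp [T] <;> ring]
    simpa using hk) (by
    rw [show T p r s t (0, 0, d) = Y - P by rw [hd]; ext <;> simp [T] <;> ring]
    simp)
  refine ⟨_, hB, fun A => ?_⟩
  have key2 : ∀ A, ∃ k : ℝ, φ A - φ P = k • (φ Y - φ P) := by
    intro A
    obtain ⟨A', hA'⟩ := T_surj p r s t hD (A - P)
    obtain ⟨k, hk⟩ := key A'
    refine ⟨k, ?_⟩
    simp only [hA', add_sub_cancel] at hk
    exact hk
  obtain ⟨k1, hk1⟩ := key2 A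
  obtain ⟨k2, hk2⟩ := key2 0
  refine ⟨k1 - k2, ?_⟩
  rw [sub_smul, ← hk1, ← hk2, h0]; abel

end Deg

section Nondeg
variable {m : ℕ}

/-- nondegeneracy -/
def Nd (φ : ℝ × ℝ × ℝ → Matrix (Fin m) (Fin m) ℝ) : Prop :=
  ∀ P X Y, ∀ k : ℝ, q (X - P) = 0 → q (Y - P) = 0 → q (X - Y) ≠ 0 → φ X - φ P ≠ k • (φ Y - φ P)

lemma Nd.ind {φ : ℝ × ℝ × ℝ → Matrix (Fin m) (Fin m) ℝ} (nd : Nd φ) {P X Y : ℝ × ℝ × ℝ}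
    {a b : ℝ} {x y : Fin m → ℝ} (h1 : q (X - P) = 0) (h2 : q (Y - P) = 0) (h3 : q (X - Y) ≠ 0)
    (hx : φ X - φ P = a • vecMulVec x x) (hy : φ Y - φ P = b • vecMulVec y y) (hb : b ≠ 0)
    (hy0 : y ≠ 0) : Ind x y := by
  by_contra hi
  obtain ⟨k, rfl⟩ := not_ind hy0 hi
  refine nd P X Y (a * k ^ 2 / b) h1 h2 h3 ?_
  rw [hx, hy, smul_sq, smul_smul, smul_smul]
  congr 1; field_simp

lemma plane_half {φ : ℝ × ℝ × ℝ → Matrix (Fin m) (Fin m) ℝ} (h : AdjP φ) (h0 : φ 0 = 0)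
    (nd : Nd φ) {n n' : ℝ × ℝ × ℝ} (hn : q n = 0) (hn' : q n' = 0) (hq : q (n + n') ≠ 0)
    {α : ℝ} {z : Fin m → ℝ} (hα : α ≠ 0) (hz : z ≠ 0) (hφ : φ n = α • vecMulVec z z) :
    ∃ (s : ℝ) (y : Fin m → ℝ), φ (n + n') = α • vecMulVec z z + s • vecMulVec y y ∧ Ind z y := by
  have hne : n + n' ≠ n := by
    intro h1; rw [h1] at hq; exact hq hn
  obtain ⟨s, y, hs, hy, hE⟩ := h (n + n') n hne (by rw [add_sub_cancel_left]; exact hn')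
  refine ⟨s, y, ?_, ?_⟩
  · rw [← hφ, ← hE]; abel
  · refine (nd.ind (P := n) (X := n + n') (Y := 0) (a := s) (b := -α) ?_ ?_ ?_ hE ?_ ?_ hz).symm
    · rw [add_sub_cancel_left]; exact hn'
    · rw [q_sub_comm, sub_zero]; exact hn
    · rw [sub_zero]; exact hq
    · rw [h0, hφ, zero_sub, neg_smul]
    · exact neg_ne_zero.2 hα

lemma plane {φ : ℝ × ℝ × ℝ → Matrix (Fin m) (Fin m) ℝ} (h : AdjP φ) (h0 : φ 0 = 0)
    (nd : Nd φ) {n n' : ℝ × ℝ × ℝ} (hn : q n = 0) (hn' : q n' = 0) (hq : q (n + n') ≠ 0)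
    {α β : ℝ} {z w : Fin m → ℝ} (hα : α ≠ 0) (hz : z ≠ 0) (hφ : φ n = α • vecMulVec z z)
    (hβ : β ≠ 0) (hw : w ≠ 0) (hφ' : φ n' = β • vecMulVec w w) :
    ∃ (s : ℝ) (y : Fin m → ℝ), φ (n + n') = α • vecMulVec z z + s • vecMulVec y y ∧ In2 z w y := by
  obtain ⟨s, y, h1, h2⟩ := plane_half h h0 nd hn hn' hq hα hz hφ
  obtain ⟨t, y', h3, h4⟩ := plane_half h h0 nd hn' hn (by rw [add_comm]; exact hq) hβ hw hφ'
  rw [add_comm, h1] at h3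
  have hi : Ind z w := by
    refine nd.ind (P := 0) (X := n) (Y := n') (by simpa using hn) (by simpa using hn') ?_
      (by rw [h0, sub_zero]; exact hφ) (by rw [h0, sub_zero]; exact hφ') hβ hw
    have e : q (n - n') = 2 * q n + 2 * q n' - q (n + n') := by
      simp only [q, Prod.fst_sub, Prod.snd_sub, Prod.fst_add, Prod.snd_add]; ring
    rw [e, hn, hn']; simpa using hq
  exact ⟨s, y, h1, LA1 hi h4 hβ h3⟩

lemma line {φ : ℝ × ℝ × ℝ → Matrix (Fin m) (Fin m) ℝ} (h : AdjP φ) (h0 : φ 0 = 0)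
    {n : ℝ × ℝ × ℝ} (hn : q n = 0) (hn0 : n ≠ 0) {α : ℝ} {z : Fin m → ℝ} (hα : α ≠ 0)
    (hz : z ≠ 0) (hφ : φ n = α • vecMulVec z z) {c : ℝ} (hc : c ≠ 0) :
    ∃ α' : ℝ, α' ≠ 0 ∧ φ (c • n) = α' • vecMulVec z z := by
  by_cases hc1 : c = 1
  · subst hc1; exact ⟨α, hα, by rw [one_smul]; exact hφ⟩
  have h1 : R1 (φ (c • n)) := by
    have := h (c • n) 0 (smul_ne_zero hc hn0) (by rw [sub_zero, q_smul, hn, mul_zero])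
    rwa [h0, sub_zero] at this
  have h2 : R1 (φ n) := ⟨α, z, hα, hz, hφ⟩
  have h3 : R1 (φ (c • n) - φ n) := by
    refine h _ _ ?_ ?_
    · intro he
      have : (c - 1) • n = 0 := by rw [sub_smul, he]; simp
      rcases smul_eq_zero.1 this with h' | h'
      · exact hc1 (by linarith)
      · exact hn0 h'
    · rw [show c • n - n = (c - 1) • n by module, q_smul, hn, mul_zero]
  obtain ⟨k, hk⟩ := R1.par h1 h2 h3
  refine ⟨k * α, mul_ne_zero ?_ hα, by rw [hk, hφ, smul_smul]⟩
  rintro rfl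
  exact h1.ne (by rw [hk, zero_smul])

lemma R1_null {φ : ℝ × ℝ × ℝ → Matrix (Fin m) (Fin m) ℝ} (h : AdjP φ) (h0 : φ 0 = 0)
    {n : ℝ × ℝ × ℝ} (hn : q n = 0) (hn0 : n ≠ 0) : R1 (φ n) := by
  have := h n 0 hn0 (by rw [sub_zero]; exact hn)
  rwa [h0, sub_zero] at this

lemma decomp_null (A : ℝ × ℝ × ℝ) (hA : q A ≠ 0) :
    ∃ n n', q n = 0 ∧ q n' = 0 ∧ A = n + n' := by
  obtain ⟨e, he, hb⟩ : ∃ e, q e = 0 ∧ bf A e ≠ 0 := by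
    obtain ⟨x, y, z⟩ := A
    by_cases hz : z = 0
    · by_cases hx : x = 0
      · refine ⟨(1, 1, 1), by simp [q], ?_⟩
        subst hz hx
        simp [q] at hA
        simp [bf, hA]
      · exact ⟨(0, 0, 1), by simp [q], by simpa [bf] using hx⟩
    · exact ⟨(1, 0, 0), by simp [q], by simpa [bf] using hz⟩
  refine ⟨(q A / bf A e) • e, A - (q A / bf A e) • e, by rw [q_smul, he, mul_zero], ?_, by abel⟩
  rw [q_sub, q_smul, he, bf_smul]; field_simp; ring

/-- direction in the plane -/
def DirIn (φ : ℝ × ℝ × ℝ → Matrix (Fin m) (Fin m) ℝ) (u v : Fin m → ℝ) (n : ℝ × ℝ × ℝ) : Prop :=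
  ∃ (c : ℝ) (w : Fin m → ℝ), c ≠ 0 ∧ w ≠ 0 ∧ φ n = c • vecMulVec w w ∧ In2 u v w

lemma DirIn.line {φ : ℝ × ℝ × ℝ → Matrix (Fin m) (Fin m) ℝ} (h : AdjP φ) (h0 : φ 0 = 0)
    {u v : Fin m → ℝ} {n : ℝ × ℝ × ℝ} (hn : q n = 0) (hn0 : n ≠ 0) (hd : DirIn φ u v n) {c : ℝ}
    (hc : c ≠ 0) : DirIn φ u v (c • n) := by
  obtain ⟨a, w, ha, hw, he, hi⟩ := hd
  obtain ⟨b, hb, hE⟩ := AdjN2.line h h0 hn hn0 ha hw he hc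
  exact ⟨b, w, hb, hw, hE, hi⟩

lemma dir_all {φ : ℝ × ℝ × ℝ → Matrix (Fin m) (Fin m) ℝ} (h : AdjP φ) (h0 : φ 0 = 0)
    (nd : Nd φ) {α β : ℝ} {u v : Fin m → ℝ} (hα : α ≠ 0) (hu : u ≠ 0)
    (hφ : φ (1, 0, 0) = α • vecMulVec u u) (hβ : β ≠ 0) (hv : v ≠ 0)
    (hφ' : φ (0, 0, 1) = β • vecMulVec v v) {n : ℝ × ℝ × ℝ} (hn : q n = 0) (hn0 : n ≠ 0) :
    DirIn φ u v n := by
  have du : DirIn φ u v (1, 0, 0) := ⟨α, u, hα, hu, hφ, 1, 0, by simp⟩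
  have dv : DirIn φ u v (0, 0, 1) := ⟨β, v, hβ, hv, hφ', 0, 1, by simp⟩
  have dp : ∀ p : ℝ, p ≠ 0 → DirIn φ u v (1, p, p ^ 2) := by
    intro p hp
    have hp2 : (2 * p ^ 2) ≠ 0 := by positivity
    have e1 : ((2 : ℝ) • ((1 : ℝ), (0 : ℝ), (0 : ℝ))) + (2 * p ^ 2) • ((0 : ℝ), (0 : ℝ), (1 : ℝ))
        = (1, p, p ^ 2) + (1, -p, p ^ 2) := by
      ext <;> simp <;> ring
    have hq : q (((1 : ℝ), p, p ^ 2) + (1, -p, p ^ 2)) ≠ 0 := by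
      simp only [q, Prod.mk_add_mk]
      intro h'
      exact hp2 (by linarith)
    obtain ⟨α', hα', hE⟩ := line h h0 (by simp [q]) (by simp) hα hu hφ (two_ne_zero (α := ℝ))
    obtain ⟨β', hβ', hE'⟩ := line h h0 (by simp [q]) (by simp) hβ hv hφ' hp2
    obtain ⟨s, y, h1, h2⟩ := plane h h0 nd (by simp [q]) (by simp [q]) (by rw [e1]; exact hq)
      hα' hu hE hβ' hv hE'
    obtain ⟨X, hX⟩ := h2.S s
    obtain ⟨γ, z, hγ, hz, hEz⟩ := R1_null h h0 (n := (1, p, p ^ 2)) (by simp [q]) (by simp)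
    obtain ⟨t, y', h3, h4⟩ := plane_half h h0 nd (by simp [q]) (by simp [q]) hq hγ hz hEz
    refine ⟨γ, z, hγ, hz, hEz, ?_⟩
    refine LA2 (X := (α', 0, 0) + X) h4 hγ (s := t) ?_
    rw [← h3, ← e1, h1, S_add, ← hX]
    simp [S]
  obtain ⟨c, p, r, rfl⟩ := null_param n hn
  have hc : c ≠ 0 := by rintro rfl; simp at hn0
  by_cases hp : p = 0
  · subst hp
    have hr : r ≠ 0 := by rintro rfl; simp at hn0
    have := dv.line h h0 (by simp [q]) (by simp) (c := c * r ^ 2) (by positivity)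
    convert this using 1
    simp
  · have hcp : c * p ^ 2 ≠ 0 := by positivity
    by_cases hr : r = 0
    · subst hr
      have := du.line h h0 (by simp [q]) (by simp) hcp
      convert this using 1
      simp
    · have := (dp (r / p) (div_ne_zero hr hp)).line h h0 (by simp [q]) (by simp) hcp
      convert this using 1
      ext <;> simp <;> field_simp

lemma S_zero (u v : Fin m → ℝ) : S u v 0 = 0 := by simp [S]

lemma all_S {φ : ℝ × ℝ × ℝ → Matrix (Fin m) (Fin m) ℝ} (h : AdjP φ) (h0 : φ 0 = 0)
    (nd : Nd φ) {α β : ℝ} {u v : Fin m → ℝ} (hα : α ≠ 0) (hu : u ≠ 0)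
    (hφ : φ (1, 0, 0) = α • vecMulVec u u) (hβ : β ≠ 0) (hv : v ≠ 0)
    (hφ' : φ (0, 0, 1) = β • vecMulVec v v) (A : ℝ × ℝ × ℝ) :
    ∃ X, φ A = S u v X := by
  have D : ∀ n : ℝ × ℝ × ℝ, q n = 0 → n ≠ 0 → DirIn φ u v n := fun n hn hn0 =>
    dir_all h h0 nd hα hu hφ hβ hv hφ' hn hn0
  by_cases hA0 : A = 0
  · exact ⟨0, by rw [hA0, h0, S_zero]⟩
  by_cases hA : q A = 0
  · obtain ⟨c, w, _, _, hE, hi⟩ := D A hA hA0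
    rw [hE]; exact hi.S c
  · obtain ⟨n, n', hn, hn', rfl⟩ := decomp_null A hA
    obtain ⟨c, w, hc, hw, hE, hi⟩ := D n hn (by rintro rfl; rw [zero_add] at hA; exact hA hn')
    obtain ⟨c', w', hc', hw', hE', hi'⟩ := D n' hn' (by
      rintro rfl; rw [add_zero] at hA; exact hA hn)
    obtain ⟨s, y, h1, h2⟩ := plane h h0 nd hn hn' hA hc hw hE hc' hw' hE'
    obtain ⟨X, hX⟩ := hi.S c
    obtain ⟨Y, hY⟩ := (In2.trans hi hi' h2).S s
    exact ⟨X + Y, by rw [h1, S_add, hX, hY]⟩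

lemma hyp_of {φ : ℝ × ℝ × ℝ → Matrix (Fin m) (Fin m) ℝ} (h : AdjP φ) (h0 : φ 0 = 0)
    (nd : Nd φ) {u v : Fin m → ℝ} (hi : Ind u v) {ψ : ℝ × ℝ × ℝ → ℝ × ℝ × ℝ}
    (hψ : ∀ A, φ A = S u v (ψ A)) : Hyp ψ := by
  have hS : ∀ A B, φ A - φ B = S u v (ψ A - ψ B) := by
    intro A B; rw [S_sub, hψ, hψ]
  have hiff : ∀ A B, q (ψ A - ψ B) = 0 ↔ q (A - B) = 0 := by
    intro A B
    constructor
    · intro hq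
      by_contra hAB
      obtain ⟨n, n', hn, hn', he⟩ := decomp_null _ hAB
      have eA : A - (B + n) = n' := by rw [← sub_sub, he]; abel
      have eB : B - (B + n) = -n := by abel
      have hqB : q (B - (B + n)) = 0 := by
        rw [q_sub_comm]; simpa using hn
      have hqA : q (A - (B + n)) = 0 := by rw [eA]; exact hn'
      have hn0 : n ≠ 0 := by
        rintro rfl
        rw [he, zero_add] at hAB; exact hAB hn'
      have hn0' : n' ≠ 0 := by
        rintro rfl
        rw [he, add_zero] at hAB; exact hAB hn
      by_cases hE : ψ A = ψ B
      · refine nd (B + n) A B 1 hqA hqB hAB ?_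
        rw [one_smul, hψ A, hE, hψ B]
      · have hR := hi.R1_S hq (sub_ne_zero.2 hE)
        rw [← hS] at hR
        obtain ⟨k, hk⟩ := R1.par (P := φ A - φ (B + n)) (Q := φ B - φ (B + n))
          (h _ _ (by intro h'; rw [sub_eq_zero.2 h'] at eA; exact hn0' eA.symm) hqA)
          (h _ _ (by simpa using hn0) hqB)
          (by rw [sub_sub_sub_cancel_right]; exact hR)
        exact nd _ _ _ k hqA hqB hAB hk
    · intro hq
      by_cases hAB : A = B
      · subst hAB; rw [sub_self, q_zero]
      · have := h A B hAB hq
        rw [hS] at this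
        exact hi.S_R1 this
  refine ⟨hi.S_inj (by rw [← hψ, h0, S_zero]), hiff, ?_⟩
  intro A B hAB
  by_contra hne
  have hq := (hiff A B).1 (by rw [hAB, sub_self, q_zero])
  exact h.ne hne hq (by rw [hψ, hψ, hAB])

lemma final {φ : ℝ × ℝ × ℝ → Matrix (Fin m) (Fin m) ℝ} (h : AdjP φ) (h0 : φ 0 = 0)
    (nd : Nd φ) : ∃ (c : ℝ) (u v : Fin m → ℝ), (c = 1 ∨ c = -1) ∧ Ind u v ∧
      ∀ A, φ A = c • S u v A := by
  obtain ⟨α, u, hα, hu, hφ⟩ := R1_null h h0 (n := (1, 0, 0)) (by simp [q]) (by simp)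
  obtain ⟨β, v, hβ, hv, hφ'⟩ := R1_null h h0 (n := (0, 0, 1)) (by simp [q]) (by simp)
  have hi : Ind u v := nd.ind (P := 0) (X := (1, 0, 0)) (Y := (0, 0, 1)) (by simp [q])
    (by simp [q]) (by simp [q]) (by rw [h0, sub_zero]; exact hφ)
    (by rw [h0, sub_zero]; exact hφ') hβ hv
  choose ψ hψ using all_S h h0 nd hα hu hφ hβ hv hφ'
  have H := hyp_of h h0 nd hi hψ
  have e1 : ψ (1, 0, 0) = (α, 0, 0) := hi.S_inj (by rw [← hψ, hφ]; simp [S])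
  have e2 : ψ (0, 0, 1) = (0, 0, β) := hi.S_inj (by rw [← hψ, hφ']; simp [S])
  have lin := H.linear
  obtain ⟨m1, m2, m3, hM⟩ : ∃ m1 m2 m3 : ℝ, ψ (1, 1, 1) - ψ (1, 0, 0) - ψ (0, 0, 1)
      = (m1, m2, m3) := ⟨_, _, _, rfl⟩
  rw [hM, e1, e2] at lin
  have lin' : ∀ x y z : ℝ, ψ (x, y, z) = (x * α + y * m1, y * m2, z * β + y * m3) := by
    intro x y z; rw [lin]; ext <;> simp
  have hq : ∀ p : ℝ, (α + p * m1) * (p ^ 2 * β + p * m3) - (p * m2) ^ 2 = 0 := by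
    intro p
    have := (H.q_iff (1, p, p ^ 2)).2 (by simp [q])
    rw [lin'] at this
    simpa [q] using this
  have q1 := hq 1
  have q2 := hq (-1)
  have q3 := hq 2
  have hm1 : m1 = 0 := by
    have : β * m1 = 0 := by linarith
    exact (mul_eq_zero.1 this).resolve_left hβ
  have hm3 : m3 = 0 := by
    have : α * m3 = 0 := by rw [hm1] at q1 q2; linarith
    exact (mul_eq_zero.1 this).resolve_left hα
  subst hm1 hm3
  have hm2 : m2 ^ 2 = α * β := by linarith
  have hm0 : m2 ≠ 0 := by
    rintro rfl
    exact mul_ne_zero hα hβ (by rw [← hm2]; ring)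
  obtain ⟨c, hc, hcα⟩ : ∃ c : ℝ, (c = 1 ∨ c = -1) ∧ 0 < c * α := by
    rcases lt_or_gt_of_ne hα with h' | h'
    · exact ⟨-1, Or.inr rfl, by linarith⟩
    · exact ⟨1, Or.inl rfl, by linarith⟩
  have hcc : c ^ 2 = 1 := by rcases hc with rfl | rfl <;> norm_num
  have hc0 : c ≠ 0 := by rintro rfl; norm_num at hcc
  obtain ⟨a, ha, ha2⟩ : ∃ a : ℝ, 0 < a ∧ a ^ 2 = c * α :=
    ⟨√(c * α), Real.sqrt_pos.2 hcα, Real.sq_sqrt hcα.le⟩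
  have ha0 : a ≠ 0 := ha.ne'
  refine ⟨c, a • u, (c * m2 / a) • v, hc, ?_, ?_⟩
  · intro s t hst
    rw [smul_smul, smul_smul] at hst
    obtain ⟨h1, h2⟩ := hi _ _ hst
    refine ⟨(mul_eq_zero.1 h1).resolve_right ha0, (mul_eq_zero.1 h2).resolve_right ?_⟩
    exact div_ne_zero (mul_ne_zero hc0 hm0) ha0
  · rintro ⟨x, y, z⟩
    rw [hψ, lin']
    have c1 : c * a ^ 2 = α := by rw [ha2, ← mul_assoc, ← sq, hcc, one_mul]
    have c2 : c * (a * (c * m2 / a)) = m2 := by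
      field_simp; rw [hcc]
    have c3 : c * (c * m2 / a) ^ 2 = β := by
      rw [div_pow, ha2, mul_pow, hcc, hm2]; field_simp
    generalize c * m2 / a = b at *
    ext i j
    simp only [S, Matrix.add_apply, Matrix.smul_apply, vecMulVec_apply, Pi.smul_apply, smul_eq_mul]
    rw [← c1, ← c2, ← c3]; ring

end Nondeg

section Fin
variable {m : ℕ}

lemma exists_R {u v : Fin m → ℝ} (h : Ind u v) : ∃ R : Matrix (Fin m) (Fin m) ℝ, IsUnit R ∧
    ∀ A : Matrix (Fin 2) (Fin 2) ℝ, A.IsSymm →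
      R * embedBlock 2 m A * Rᵀ = S u v (A 0 0, A 0 1, A 1 1) := by
  have hli : LinearIndependent ℝ ![u, v] := LinearIndependent.pair_iff.2 h
  obtain ⟨ι, b, hb⟩ : ∃ (ι : Type) (b : Module.Basis (Fin 2 ⊕ ι) ℝ (Fin m → ℝ)),
      ∀ a, b (Sum.inl a) = ![u, v] a := by
    refine ⟨_, Module.Basis.sumExtend hli, fun a => ?_⟩
    simp [Module.Basis.sumExtend]
    rfl
  have : Finite (Fin 2 ⊕ ι) := Module.Finite.finite_basis b
  have : Finite ι := Finite.of_injective (Sum.inr : ι → Fin 2 ⊕ ι) Sum.inr_injective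
  obtain ⟨k, ⟨e⟩⟩ := Finite.exists_equiv_fin ι
  have b2 := b.reindex ((Equiv.sumCongr (Equiv.refl _) e).trans finSumFinEquiv)
  have hm : m = 2 + k := by
    have := Module.finrank_eq_card_basis b2
    simpa using this
  clear b2
  subst hm
  obtain ⟨b', hb'⟩ : ∃ b' : Module.Basis (Fin (2 + k)) ℝ (Fin (2 + k) → ℝ),
      ∀ a, b' (Fin.castAdd k a) = ![u, v] a := by
    refine ⟨b.reindex ((Equiv.sumCongr (Equiv.refl _) e).trans finSumFinEquiv), fun a => ?_⟩
    rw [Module.Basis.reindex_apply, ← hb]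
    congr 1
    rw [Equiv.symm_apply_eq]
    simp
  refine ⟨Matrix.of fun i j => b' j i, ?_, ?_⟩
  · rw [← Matrix.linearIndependent_cols_iff_isUnit]
    exact b'.linearIndependent
  · intro A hA
    have h10 : A 1 0 = A 0 1 := hA.apply 0 1
    have h0 := hb' 0
    have h1 := hb' 1
    simp only [Matrix.cons_val_zero, Matrix.cons_val_one] at h0 h1
    have hE : ∀ a b : Fin 2, embedBlock 2 (2 + k) A (Fin.castAdd k a) (Fin.castAdd k b) = A a b := by
      intro a b; fin_cases a <;> fin_cases b <;> simp [embedBlock]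
    have hE1 : ∀ (a : Fin k) b, embedBlock 2 (2 + k) A (Fin.natAdd 2 a) b = 0 := by
      intro a b; simp [embedBlock]; intros; omega
    have hE2 : ∀ a (b : Fin k), embedBlock 2 (2 + k) A a (Fin.natAdd 2 b) = 0 := by
      intro a b; simp [embedBlock]; intros; omega
    ext i j
    simp only [Matrix.mul_apply, Fin.sum_univ_add, hE, hE1, hE2, Matrix.transpose_apply,
      Matrix.of_apply, mul_zero, zero_mul, Finset.sum_const_zero, add_zero, Fin.sum_univ_two,
      h0, h1, h10, S, Matrix.add_apply, Matrix.smul_apply, vecMulVec_apply, smul_eq_mul]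
    ring

/-- coordinates to matrix -/
def mk (A : ℝ × ℝ × ℝ) : Matrix (Fin 2) (Fin 2) ℝ := !![A.1, A.2.1; A.2.1, A.2.2]

lemma mk_symm (A : ℝ × ℝ × ℝ) : (mk A).IsSymm := by
  ext i j; fin_cases i <;> fin_cases j <;> simp [mk]

lemma mk_of {A : Matrix (Fin 2) (Fin 2) ℝ} (h : A.IsSymm) : A = mk (A 0 0, A 0 1, A 1 1) := by
  have h10 : A 1 0 = A 0 1 := h.apply 0 1
  ext i j; fin_cases i <;> fin_cases j <;> simp [mk, h10]

lemma mk_zero : mk 0 = 0 := by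
  ext i j; fin_cases i <;> fin_cases j <;> simp [mk]

lemma mk_rank {A B : ℝ × ℝ × ℝ} (hAB : A ≠ B) (hq : q (A - B) = 0) : (mk A - mk B).rank = 1 := by
  apply R1.rank
  obtain ⟨c, p, r, hc⟩ := null_param _ hq
  have hne : A - B ≠ 0 := sub_ne_zero.2 hAB
  rw [hc] at hne
  refine ⟨c, ![p, r], ?_, ?_, ?_⟩
  · rintro rfl; simp at hne
  · intro h0
    have h1 := congrFun h0 0
    have h2 := congrFun h0 1
    simp at h1 h2
    subst h1 h2
    simp at hne
  · rw [show mk A - mk B = mk (A - B) by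
      ext i j; fin_cases i <;> fin_cases j <;> simp [mk], hc]
    ext i j; fin_cases i <;> fin_cases j <;> simp [mk, sq, mul_comm, mul_left_comm]

end Fin

end AdjN2

/-- The case `n = 2` of the main theorem: an adjacency preserving map
`Φ : S_2 → S_m` (`m ≥ 1`) with `Φ(0) = 0` is either degenerate or standard. -/
theorem main_theorem_n2 (m : ℕ) (hm : 1 ≤ m)
    (Φ : Matrix (Fin 2) (Fin 2) ℝ → Matrix (Fin m) (Fin m) ℝ)
    (hΦsym : ∀ A : Matrix (Fin 2) (Fin 2) ℝ, A.IsSymm → (Φ A).IsSymm)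
    (hΦadj : ∀ A B : Matrix (Fin 2) (Fin 2) ℝ, A.IsSymm → B.IsSymm →
      (A - B).rank = 1 → (Φ A - Φ B).rank = 1)
    (hΦ0 : Φ 0 = 0) :
    (∃ B : Matrix (Fin m) (Fin m) ℝ, B.IsSymm ∧ B.rank = 1 ∧
      ∃ f : Matrix (Fin 2) (Fin 2) ℝ → ℝ,
        ∀ A : Matrix (Fin 2) (Fin 2) ℝ, A.IsSymm → Φ A = f A • B) ∨
    (∃ c : ℝ, (c = 1 ∨ c = -1) ∧ ∃ R : Matrix (Fin m) (Fin m) ℝ, IsUnit R ∧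
      ∀ A : Matrix (Fin 2) (Fin 2) ℝ, A.IsSymm →
        Φ A = c • (R * embedBlock 2 m A * Rᵀ)) := by
  have h : AdjN2.AdjP (fun A => Φ (AdjN2.mk A)) := by
    intro A B hAB hq
    refine AdjN2.R1.of_rank ?_ ?_
    · exact (hΦsym _ (AdjN2.mk_symm A)).sub (hΦsym _ (AdjN2.mk_symm B))
    · exact hΦadj _ _ (AdjN2.mk_symm A) (AdjN2.mk_symm B) (AdjN2.mk_rank hAB hq)
  have h0 : (fun A => Φ (AdjN2.mk A)) 0 = 0 := by
    simp only [AdjN2.mk_zero, hΦ0]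
  by_cases hdeg : ∃ B, AdjN2.R1 B ∧ ∀ A, ∃ t : ℝ, Φ (AdjN2.mk A) = t • B
  · left
    obtain ⟨B, hB, hf⟩ := hdeg
    choose f hf using hf
    refine ⟨B, hB.symm, hB.rank, fun A => f (A 0 0, A 0 1, A 1 1), fun A hA => ?_⟩
    rw [← hf, ← AdjN2.mk_of hA]
  · right
    have nd : AdjN2.Nd (fun A => Φ (AdjN2.mk A)) := by
      intro P X Y k h1 h2 h3 h4
      exact hdeg (h.deg h0 h1 h2 h3 h4)
    obtain ⟨c, u, v, hc, hi, hE⟩ := AdjN2.final h h0 nd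
    obtain ⟨R, hR, hRE⟩ := AdjN2.exists_R hi
    refine ⟨c, hc, R, hR, fun A hA => ?_⟩
    have := hE (A 0 0, A 0 1, A 1 1)
    rw [hRE A hA, ← this, ← AdjN2.mk_of hA]
end
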